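/- arXiv:1310.7993 — 9 statements merged into one kernel-verified Lean document; each statement's English description precedes it below -/
import Mathlib

section
/- Let E be a nontrivial finite-dimensional real inner product space, let f : E → ℝ be twice continuously differentiable, K ∈ ℝ and N < 0. Then the following are equivalent: (i) for all x, v ∈ E one has D²f(x)(v,v) − ⟨∇f(x), v⟩²/N ≥ K‖v‖²; (ii) for all x₀, x₁ ∈ E with d := ‖x₀ − x₁‖ (satisfying d < π√(N/K) when K < 0) and all t ∈ [0,1], f_N((1−t)x₀ + t x₁) ≤ σ_{K/N}^{(1−t)}(d)·f_N(x₀) + σ_{K/N}^{(t)}(d)·f_N(x₁); (iii) for all x₀ ≠ x₁ in E with d := ‖x₀ − x₁‖ (satisfying d < π√(N/K) when K < 0), f_N(x₁) ≥ 𝔠_{K/N}(d)·f_N(x₀) − (𝔰_{K/N}(d)/(N d))·f_N(x₀)·⟨∇f(x₀), x₁ − x₀⟩. -/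
open Real
open scoped RealInnerProductSpace

/-- The comparison function `𝔰_κ`. -/
noncomputable def sk (κ θ : ℝ) : ℝ :=
  if 0 < κ then Real.sin (Real.sqrt κ * θ) / Real.sqrt κ
  else if κ = 0 then θ
  else Real.sinh (Real.sqrt (-κ) * θ) / Real.sqrt (-κ)

/-- The comparison function `𝔠_κ`. -/
noncomputable def ck (κ θ : ℝ) : ℝ :=
  if 0 < κ then Real.cos (Real.sqrt κ * θ)
  else if κ = 0 then 1
  else Real.cosh (Real.sqrt (-κ) * θ)

/-- The distortion coefficient `σ_κ^{(t)}(θ)`. -/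
noncomputable def sg (κ t θ : ℝ) : ℝ := if θ = 0 then t else sk κ (t * θ) / sk κ θ

lemma sk_zero (κ : ℝ) : sk κ 0 = 0 := by
  unfold sk; split_ifs <;> simp

lemma ck_zero (κ : ℝ) : ck κ 0 = 1 := by
  unfold ck; split_ifs <;> simp

lemma sk_hasDerivAt (κ θ : ℝ) : HasDerivAt (sk κ) (ck κ θ) θ := by
  rcases lt_trichotomy κ 0 with h | h | h
  · have hs : Real.sqrt (-κ) ≠ 0 := (Real.sqrt_pos.2 (by linarith)).ne'
    have e : sk κ = fun θ => Real.sinh (Real.sqrt (-κ) * θ) / Real.sqrt (-κ) := by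
      funext y; simp [sk, h.ne, h.le, not_lt.2 h.le]
    rw [e]
    have := (((hasDerivAt_id θ).const_mul (Real.sqrt (-κ))).sinh).div_const (Real.sqrt (-κ))
    refine this.congr_deriv ?_
    simp [ck, h.ne, not_lt.2 h.le]
    field_simp
  · subst h
    have e : sk 0 = fun θ => θ := by funext y; simp [sk]
    rw [e]
    exact (hasDerivAt_id' θ).congr_deriv (by simp [ck])
  · have hs : Real.sqrt κ ≠ 0 := (Real.sqrt_pos.2 h).ne'
    have e : sk κ = fun θ => Real.sin (Real.sqrt κ * θ) / Real.sqrt κ := by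
      funext y; simp [sk, h]
    rw [e]
    have := (((hasDerivAt_id θ).const_mul (Real.sqrt κ)).sin).div_const (Real.sqrt κ)
    refine this.congr_deriv ?_
    simp [ck, h]
    field_simp

lemma ck_hasDerivAt (κ θ : ℝ) : HasDerivAt (ck κ) (-κ * sk κ θ) θ := by
  rcases lt_trichotomy κ 0 with h | h | h
  · have hs : Real.sqrt (-κ) ≠ 0 := (Real.sqrt_pos.2 (by linarith)).ne'
    have hq : Real.sqrt (-κ) ^ 2 = -κ := Real.sq_sqrt (by linarith)
    have e : ck κ = fun θ => Real.cosh (Real.sqrt (-κ) * θ) := by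
      funext y; simp [ck, h.ne, not_lt.2 h.le]
    rw [e]
    have := (((hasDerivAt_id θ).const_mul (Real.sqrt (-κ))).cosh)
    refine this.congr_deriv ?_
    simp only [sk, h.ne, not_lt.2 h.le, if_false, id]
    field_simp
    rw [hq]
    ring
  · subst h
    have e : ck 0 = fun θ => 1 := by funext y; simp [ck]
    rw [e]
    simpa using hasDerivAt_const θ (1:ℝ)
  · have hs : Real.sqrt κ ≠ 0 := (Real.sqrt_pos.2 h).ne'
    have hq : Real.sqrt κ ^ 2 = κ := Real.sq_sqrt h.le
    have e : ck κ = fun θ => Real.cos (Real.sqrt κ * θ) := by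
      funext y; simp [ck, h]
    rw [e]
    have := (((hasDerivAt_id θ).const_mul (Real.sqrt κ)).cos)
    refine this.congr_deriv ?_
    simp only [sk, h, if_true, id]
    field_simp
    rw [hq]
    ring

lemma sk_add (κ a b : ℝ) : sk κ (a + b) = sk κ a * ck κ b + ck κ a * sk κ b := by
  unfold sk ck
  split_ifs
  · rw [mul_add, Real.sin_add]; ring
  · ring
  · rw [mul_add, Real.sinh_add]; ring

lemma sk_pos (κ θ : ℝ) (h0 : 0 < θ) (h : 0 < κ → Real.sqrt κ * θ < π) : 0 < sk κ θ := by
  unfold sk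
  split_ifs with h1 h2
  · have := Real.sqrt_pos.2 h1
    exact div_pos (Real.sin_pos_of_pos_of_lt_pi (by positivity) (h h1)) this
  · exact h0
  · have : 0 < Real.sqrt (-κ) := Real.sqrt_pos.2 (by
      rcases lt_or_eq_of_le (not_lt.1 h1) with h | h
      · linarith
      · exact absurd h h2)
    exact div_pos (Real.sinh_pos_iff.2 (by positivity)) this

lemma cond_iff (K N d : ℝ) (hN : N < 0) :
    (K < 0 → d < π * Real.sqrt (N / K)) ↔ (0 < K / N → Real.sqrt (K / N) * d < π) := by
  have hk : K < 0 ↔ 0 < K / N := by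
    constructor
    · intro h; exact div_pos_of_neg_of_neg h hN
    · intro h
      by_contra h'
      have := div_nonpos_of_nonneg_of_nonpos (not_lt.1 h') hN.le
      linarith
  rw [hk]
  refine imp_congr_right fun h => ?_
  have hs := Real.sqrt_pos.2 h
  rw [← inv_div K N, Real.sqrt_inv, ← div_eq_mul_inv, lt_div_iff₀ hs, mul_comm]

section line
variable {E : Type*} [NormedAddCommGroup E] [InnerProductSpace ℝ E]
    [FiniteDimensional ℝ E]

lemma line_hasDerivAt (x v : E) (s : ℝ) : HasDerivAt (fun s : ℝ => x + s • v) v s := by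
  simpa using ((hasDerivAt_id s).smul_const v).const_add x

lemma inner_grad (f : E → ℝ) (x v : E) : ⟪gradient f x, v⟫ = fderiv ℝ f x v := by
  simp [gradient]

lemma u_hasDerivAt (f : E → ℝ) (hf : ContDiff ℝ 2 f) (N : ℝ) (x v : E) (s : ℝ) :
    HasDerivAt (fun s : ℝ => Real.exp (-f (x + s • v) / N))
      (-(fderiv ℝ f (x + s • v) v) / N * Real.exp (-f (x + s • v) / N)) s := by
  have h1 : HasFDerivAt f (fderiv ℝ f (x + s • v)) (x + s • v) :=
    (hf.differentiable (by norm_num) _).hasFDerivAt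
  have h2 := h1.comp_hasDerivAt s (line_hasDerivAt x v s)
  refine ((h2.neg.div_const N).exp).congr_deriv ?_
  simp [mul_comm]

lemma uderiv_hasDerivAt (f : E → ℝ) (hf : ContDiff ℝ 2 f) (N : ℝ) (x v : E) (s : ℝ) :
    HasDerivAt (fun s : ℝ => -(fderiv ℝ f (x + s • v) v) / N * Real.exp (-f (x + s • v) / N))
      (-(1 / N) * (fderiv ℝ (fderiv ℝ f) (x + s • v) v v
        - ⟪gradient f (x + s • v), v⟫ ^ 2 / N) * Real.exp (-f (x + s • v) / N)) s := by
  have hd : Differentiable ℝ (fderiv ℝ f) :=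
    (hf.fderiv_right (m := 1) (by norm_num)).differentiable (by norm_num)
  have h1 := (hd (x + s • v)).hasFDerivAt
  have h2 := h1.comp_hasDerivAt s (line_hasDerivAt x v s)
  have h3 := h2.clm_apply (hasDerivAt_const s v)
  refine ((h3.neg.div_const N).mul (u_hasDerivAt f hf N x v s)).congr_deriv ?_
  rw [inner_grad]
  simp
  ring

lemma i_to_iii (f : E → ℝ) (hf : ContDiff ℝ 2 f) (K N : ℝ) (hN : N < 0)
    (h : ∀ x v : E, K * ‖v‖ ^ 2 ≤ fderiv ℝ (fderiv ℝ f) x v v - ⟪gradient f x, v⟫ ^ 2 / N)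
    (x₀ x₁ : E) (hne : x₀ ≠ x₁) (hd : K < 0 → ‖x₀ - x₁‖ < π * Real.sqrt (N / K)) :
    ck (K / N) ‖x₀ - x₁‖ * Real.exp (-f x₀ / N)
            - sk (K / N) ‖x₀ - x₁‖ / (N * ‖x₀ - x₁‖) * Real.exp (-f x₀ / N)
                * ⟪gradient f x₀, x₁ - x₀⟫
            ≤ Real.exp (-f x₁ / N) := by
  rw [cond_iff K N _ hN] at hd
  have hdpos : 0 < ‖x₀ - x₁‖ := norm_pos_iff.2 (sub_ne_zero.2 hne)
  have hv : ‖x₁ - x₀‖ = ‖x₀ - x₁‖ := norm_sub_rev _ _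
  rw [inner_grad]
  generalize ‖x₀ - x₁‖ = d at *
  set v := x₁ - x₀ with hvdef
  have hx1 : x₀ + (1:ℝ) • v = x₁ := by simp [hvdef]
  have hx0 : x₀ + (0:ℝ) • v = x₀ := by simp
  set κ := K / N with hκ
  set u : ℝ → ℝ := fun s => Real.exp (-f (x₀ + s • v) / N) with hu
  set du : ℝ → ℝ := fun s => -(fderiv ℝ f (x₀ + s • v) v) / N * Real.exp (-f (x₀ + s • v) / N)
    with hdu
  let w : ℝ → ℝ := fun s => sk κ (d * (1 - s)) * du s + d * ck κ (d * (1 - s)) * u s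
  have hlin : ∀ s : ℝ, HasDerivAt (fun s : ℝ => d * (1 - s)) (-d) s := fun s => by
    simpa using ((hasDerivAt_id s).const_sub 1).const_mul d
  have hw : ∀ s : ℝ, HasDerivAt w (sk κ (d * (1 - s)) * (-(1 / N) *
      (fderiv ℝ (fderiv ℝ f) (x₀ + s • v) v v - ⟪gradient f (x₀ + s • v), v⟫ ^ 2 / N
        - K * d ^ 2) * u s)) s := by
    intro s
    have a := ((sk_hasDerivAt κ (d * (1 - s))).comp s (hlin s)).mul (uderiv_hasDerivAt f hf N x₀ v s)
    have b := (((ck_hasDerivAt κ (d * (1 - s))).comp s (hlin s)).const_mul d).mul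
      (u_hasDerivAt f hf N x₀ v s)
    refine (a.add b).congr_deriv ?_
    simp only [Function.comp, hu, hκ]
    ring
  have hmono : MonotoneOn w (Set.Icc 0 1) := by
    refine monotoneOn_of_deriv_nonneg (convex_Icc 0 1)
      (fun s _ => (hw s).continuousAt.continuousWithinAt)
      (fun s _ => (hw s).differentiableAt.differentiableWithinAt) ?_
    intro s hs
    rw [interior_Icc] at hs
    rw [(hw s).deriv]
    have h1 : 0 < d * (1 - s) := mul_pos hdpos (by linarith [hs.2])
    have h2 : 0 < sk κ (d * (1 - s)) := sk_pos _ _ h1 (fun hk => by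
      refine lt_of_le_of_lt ?_ (hd hk)
      refine mul_le_mul_of_nonneg_left ?_ (Real.sqrt_nonneg _)
      nlinarith [hs.1])
    have h3 := h (x₀ + s • v) v
    rw [hv] at h3
    have h4 : 0 < -(1 / N) := by
      have := one_div_neg.2 hN
      linarith
    have h5 : 0 < u s := Real.exp_pos _
    exact mul_nonneg h2.le (mul_nonneg (mul_nonneg h4.le (by linarith)) h5.le)
  have hfin := hmono (Set.left_mem_Icc.2 zero_le_one) (Set.right_mem_Icc.2 zero_le_one) zero_le_one
  simp only [w, hu, hdu, hx0, hx1, sub_zero, sub_self, mul_zero, mul_one, sk_zero, ck_zero] at hfin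
  have hNne : N ≠ 0 := hN.ne
  refine le_of_mul_le_mul_left ?_ hdpos
  refine le_trans (le_of_eq ?_) (hfin.trans (le_of_eq ?_))
  · field_simp
    ring
  · ring

lemma iii_to_ii (f : E → ℝ) (K N : ℝ) (hN : N < 0)
    (h : ∀ x₀ x₁ : E, x₀ ≠ x₁ → (K < 0 → ‖x₀ - x₁‖ < π * Real.sqrt (N / K)) →
          ck (K / N) ‖x₀ - x₁‖ * Real.exp (-f x₀ / N)
            - sk (K / N) ‖x₀ - x₁‖ / (N * ‖x₀ - x₁‖) * Real.exp (-f x₀ / N)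
                * ⟪gradient f x₀, x₁ - x₀⟫
            ≤ Real.exp (-f x₁ / N))
    (x₀ x₁ : E) (hd : K < 0 → ‖x₀ - x₁‖ < π * Real.sqrt (N / K))
    (t : ℝ) (ht : t ∈ Set.Icc (0:ℝ) 1) :
    Real.exp (-f ((1 - t) • x₀ + t • x₁) / N) ≤
              sg (K / N) (1 - t) ‖x₀ - x₁‖ * Real.exp (-f x₀ / N)
                + sg (K / N) t ‖x₀ - x₁‖ * Real.exp (-f x₁ / N) := by
  by_cases hne : x₀ = x₁
  · subst hne
    rw [← add_smul]
    simp [sg]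
    rw [← add_mul]; simp
  have hdpos : 0 < ‖x₀ - x₁‖ := norm_pos_iff.2 (sub_ne_zero.2 hne)
  have hskd : 0 < sk (K / N) ‖x₀ - x₁‖ := sk_pos _ _ hdpos ((cond_iff K N _ hN).1 hd)
  rcases eq_or_lt_of_le ht.1 with h0 | h0
  · subst h0
    simp [sg, hdpos.ne', sk_zero, hskd.ne', sub_ne_zero.2 hne]
  rcases eq_or_lt_of_le ht.2 with h1 | h1
  · subst h1
    simp [sg, hdpos.ne', sk_zero, hskd.ne', sub_ne_zero.2 hne]
  set m := (1 - t) • x₀ + t • x₁ with hm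
  have e0 : x₀ - m = (-t) • (x₁ - x₀) := by rw [hm]; module
  have e1 : x₁ - m = (1 - t) • (x₁ - x₀) := by rw [hm]; module
  have n0 : ‖m - x₀‖ = t * ‖x₀ - x₁‖ := by
    rw [norm_sub_rev, e0, norm_smul, norm_sub_rev x₁]; simp [abs_of_pos h0]
  have n1 : ‖m - x₁‖ = (1 - t) * ‖x₀ - x₁‖ := by
    rw [norm_sub_rev, e1, norm_smul, norm_sub_rev x₁, Real.norm_eq_abs,
      abs_of_pos (by linarith)]
  have p0 : 0 < t * ‖x₀ - x₁‖ := by positivity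
  have p1 : 0 < (1 - t) * ‖x₀ - x₁‖ := mul_pos (by linarith) hdpos
  have c0 : K < 0 → t * ‖x₀ - x₁‖ < π * Real.sqrt (N / K) :=
    fun hk => lt_of_le_of_lt (by nlinarith) (hd hk)
  have c1 : K < 0 → (1 - t) * ‖x₀ - x₁‖ < π * Real.sqrt (N / K) :=
    fun hk => lt_of_le_of_lt (by nlinarith) (hd hk)
  have s0 := sk_pos _ _ p0 ((cond_iff K N _ hN).1 c0)
  have s1 := sk_pos _ _ p1 ((cond_iff K N _ hN).1 c1)
  have i0 := h m x₀ (fun hh => by rw [hh] at n0; simp at n0; rcases n0 with h | h <;> [linarith; exact hne (sub_eq_zero.1 h)]) (by rw [n0]; exact c0)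
  have i1 := h m x₁ (fun hh => by rw [hh] at n1; simp at n1; rcases n1 with h | h <;> [linarith; exact hne (sub_eq_zero.1 h)]) (by rw [n1]; exact c1)
  rw [n0, e0, inner_smul_right] at i0
  rw [n1, e1, inner_smul_right] at i1
  have hadd := sk_add (K / N) (t * ‖x₀ - x₁‖) ((1 - t) * ‖x₀ - x₁‖)
  rw [show t * ‖x₀ - x₁‖ + (1 - t) * ‖x₀ - x₁‖ = ‖x₀ - x₁‖ by ring] at hadd
  simp only [sg, hdpos.ne', if_false]
  generalize ⟪gradient f m, x₁ - x₀⟫ = g at *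
  generalize ‖x₀ - x₁‖ = d at *
  generalize Real.exp (-f m / N) = um at *
  generalize Real.exp (-f x₀ / N) = u0 at *
  generalize Real.exp (-f x₁ / N) = u1 at *
  have t1 : (1 - t) ≠ 0 := by linarith
  have j0 := mul_le_mul_of_nonneg_left i0 s1.le
  have j1 := mul_le_mul_of_nonneg_left i1 s0.le
  generalize sk (K / N) (t * d) = S0 at *
  generalize sk (K / N) ((1 - t) * d) = S1 at *
  have hNne := hN.ne
  rw [div_mul_eq_mul_div, div_mul_eq_mul_div, ← add_div, le_div_iff₀ hskd, hadd]
  refine le_trans (le_of_eq ?_) (add_le_add j0 j1)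
  field_simp
  ring

lemma ii_to_i (f : E → ℝ) (hf : ContDiff ℝ 2 f) (K N : ℝ) (hN : N < 0)
    (h : ∀ x₀ x₁ : E, (K < 0 → ‖x₀ - x₁‖ < π * Real.sqrt (N / K)) →
          ∀ t ∈ Set.Icc (0:ℝ) 1,
            Real.exp (-f ((1 - t) • x₀ + t • x₁) / N) ≤
              sg (K / N) (1 - t) ‖x₀ - x₁‖ * Real.exp (-f x₀ / N)
                + sg (K / N) t ‖x₀ - x₁‖ * Real.exp (-f x₁ / N))
    (x v : E) :
    K * ‖v‖ ^ 2 ≤ fderiv ℝ (fderiv ℝ f) x v v - ⟪gradient f x, v⟫ ^ 2 / N := by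
  by_cases hv : v = 0
  · subst hv; simp
  have hvpos : 0 < ‖v‖ := norm_pos_iff.2 hv
  have hNne := hN.ne
  set κ := K / N with hκ
  set u : ℝ → ℝ := fun s => Real.exp (-f (x + s • v) / N) with hu
  set du : ℝ → ℝ := fun s => -(fderiv ℝ f (x + s • v) v) / N * Real.exp (-f (x + s • v) / N)
    with hdu
  have hmid : ∀ s : ℝ, 0 < s → (K < 0 → 2 * s * ‖v‖ < π * Real.sqrt (N / K)) →
      2 * ck κ (s * ‖v‖) * u 0 ≤ u s + u (-s) := by
    intro s hs hc
    have hn : ‖(x + (-s) • v) - (x + s • v)‖ = 2 * s * ‖v‖ := by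
      rw [show (x + (-s) • v) - (x + s • v) = (-(2 * s)) • v by module, norm_smul]
      simp [abs_of_pos hs]
    have key := h (x + (-s) • v) (x + s • v) (by rw [hn]; exact hc) (1 / 2) ⟨by norm_num, by norm_num⟩
    rw [hn, show ((1:ℝ) - 1 / 2) • (x + (-s) • v) + ((1:ℝ) / 2) • (x + s • v) = x + (0:ℝ) • v by
      module] at key
    have q : 0 < s * ‖v‖ := by positivity
    have q2 : 0 < 2 * s * ‖v‖ := by positivity
    have S2 := sk_pos _ _ q2 ((cond_iff K N _ hN).1 hc)
    have S1 := sk_pos _ _ q ((cond_iff K N _ hN).1 (fun hk => lt_of_le_of_lt (by nlinarith) (hc hk)))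
    have hadd := sk_add (K / N) (s * ‖v‖) (s * ‖v‖)
    rw [show s * ‖v‖ + s * ‖v‖ = 2 * s * ‖v‖ by ring] at hadd
    simp only [sg, q2.ne', if_false] at key
    rw [show ((1:ℝ) - 1 / 2) * (2 * s * ‖v‖) = s * ‖v‖ by ring,
      show ((1:ℝ) / 2) * (2 * s * ‖v‖) = s * ‖v‖ by ring,
      div_mul_eq_mul_div, div_mul_eq_mul_div, ← add_div, le_div_iff₀ S2, hadd] at key
    refine le_of_mul_le_mul_left ?_ S1
    simp only [hu]
    refine le_trans (le_of_eq ?_) (key.trans (le_of_eq ?_)) <;> ring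
  let g : ℝ → ℝ := fun s => u s + u (-s) - 2 * ck κ (s * ‖v‖) * u 0
  let g' : ℝ → ℝ := fun s => du s - du (-s) + 2 * (κ * sk κ (s * ‖v‖) * ‖v‖) * u 0
  have hlin : ∀ s : ℝ, HasDerivAt (fun s : ℝ => s * ‖v‖) ‖v‖ s := fun s => by
    simpa using (hasDerivAt_id s).mul_const ‖v‖
  have hg : ∀ s, HasDerivAt g (g' s) s := by
    intro s
    have a := u_hasDerivAt f hf N x v s
    have b := (u_hasDerivAt f hf N x v (-s)).comp s (hasDerivAt_neg s)
    have c := (((ck_hasDerivAt κ (s * ‖v‖)).comp s (hlin s)).const_mul 2).mul_const (u 0)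
    refine ((a.add b).sub c).congr_deriv ?_
    simp only [g', hdu]
    ring
  set H := fderiv ℝ (fderiv ℝ f) x v v - ⟪gradient f x, v⟫ ^ 2 / N with hH
  have hg' : HasDerivAt g' (-(2 / N) * (H - K * ‖v‖ ^ 2) * u 0) 0 := by
    have a := uderiv_hasDerivAt f hf N x v 0
    have b := (uderiv_hasDerivAt f hf N x v (-0)).comp 0 (hasDerivAt_neg (0:ℝ))
    have c := (((((sk_hasDerivAt κ (0 * ‖v‖)).comp 0 (hlin 0)).const_mul κ).mul_const ‖v‖).const_mul
      2).mul_const (u 0)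
    refine ((a.sub b).add c).congr_deriv ?_
    simp only [hu, hH, hκ, neg_zero, zero_smul, add_zero, zero_mul, ck_zero]
    field_simp
    ring
  have hderiv : deriv g = g' := funext fun s => (hg s).deriv
  have hu0 : 0 < u 0 := Real.exp_pos _
  have hge : ∀ᶠ s in nhds (0:ℝ), 0 ≤ g s := by
    have : ∀ᶠ s in nhds (0:ℝ), (K < 0 → 2 * |s| * ‖v‖ < π * Real.sqrt (N / K)) := by
      by_cases hk : K < 0
      · have hpos : 0 < π * Real.sqrt (N / K) :=
          mul_pos Real.pi_pos (Real.sqrt_pos.2 (div_pos_of_neg_of_neg hN hk))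
        have hcont : Continuous fun s : ℝ => 2 * |s| * ‖v‖ := by fun_prop
        have := hcont.continuousAt.eventually_lt (x₀ := (0:ℝ)) continuousAt_const
          (by simpa using hpos)
        filter_upwards [this] with s hs _ using hs
      · exact Filter.Eventually.of_forall fun s hk' => absurd hk' hk
    filter_upwards [this] with s hs
    rcases lt_trichotomy s 0 with h0 | h0 | h0
    · have := hmid (-s) (by linarith) (by rwa [abs_of_neg h0] at hs)
      have ev : ck κ (-s * ‖v‖) = ck κ (s * ‖v‖) := by
        unfold ck; split_ifs <;> simp
      rw [ev, neg_neg] at this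
      simp only [g]; linarith
    · subst h0; simp [g, ck_zero]; linarith
    · have := hmid s h0 (by rwa [abs_of_pos h0] at hs)
      simp only [g]; linarith
  by_contra hcon
  have hneg : -(2 / N) * (H - K * ‖v‖ ^ 2) * u 0 < 0 := by
    have h4 : 0 < -(2 / N) := by
      have := div_neg_of_pos_of_neg (two_pos (α := ℝ)) hN
      linarith
    exact mul_neg_of_neg_of_pos (mul_neg_of_pos_of_neg h4 (by linarith)) hu0
  have hg0 : g 0 = 0 := by simp [g, ck_zero]; ring
  have hgp_zero : g' 0 = 0 := by simp [g', sk_zero]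
  have hmax : IsLocalMax g 0 := isLocalMax_of_deriv_deriv_neg
    (by rw [hderiv, hg'.deriv]; exact hneg) (by rw [hderiv, hgp_zero]) (hg 0).continuousAt
  have hz : g =ᶠ[nhds 0] fun _ => (0:ℝ) := by
    filter_upwards [hge, hmax] with s a b
    rw [hg0] at b
    exact le_antisymm b a
  have hz' : g' =ᶠ[nhds 0] fun _ => (0:ℝ) := by
    have := hz.deriv
    rw [hderiv] at this
    simpa using this
  have := hz'.deriv_eq
  rw [hg'.deriv] at this
  simp only [deriv_const] at this
  linarith
end line

theorem stmt_0 {E : Type*} [NormedAddCommGroup E] [InnerProductSpace ℝ E]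
    [FiniteDimensional ℝ E] [Nontrivial E]
    (f : E → ℝ) (hf : ContDiff ℝ 2 f) (K N : ℝ) (hN : N < 0) :
    ((∀ x v : E, K * ‖v‖ ^ 2 ≤ fderiv ℝ (fderiv ℝ f) x v v - ⟪gradient f x, v⟫ ^ 2 / N)
      ↔ (∀ x₀ x₁ : E, (K < 0 → ‖x₀ - x₁‖ < π * Real.sqrt (N / K)) →
          ∀ t ∈ Set.Icc (0:ℝ) 1,
            Real.exp (-f ((1 - t) • x₀ + t • x₁) / N) ≤
              sg (K / N) (1 - t) ‖x₀ - x₁‖ * Real.exp (-f x₀ / N)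
                + sg (K / N) t ‖x₀ - x₁‖ * Real.exp (-f x₁ / N)))
    ∧
    ((∀ x v : E, K * ‖v‖ ^ 2 ≤ fderiv ℝ (fderiv ℝ f) x v v - ⟪gradient f x, v⟫ ^ 2 / N)
      ↔ (∀ x₀ x₁ : E, x₀ ≠ x₁ → (K < 0 → ‖x₀ - x₁‖ < π * Real.sqrt (N / K)) →
          ck (K / N) ‖x₀ - x₁‖ * Real.exp (-f x₀ / N)
            - sk (K / N) ‖x₀ - x₁‖ / (N * ‖x₀ - x₁‖) * Real.exp (-f x₀ / N)
                * ⟪gradient f x₀, x₁ - x₀⟫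
            ≤ Real.exp (-f x₁ / N))) := by
  have h13 := i_to_iii f hf K N hN
  have h32 := iii_to_ii f K N hN
  have h21 := ii_to_i f hf K N hN
  exact ⟨⟨fun h => h32 (h13 h), h21⟩, ⟨h13, fun h => h21 (h32 h)⟩⟩
end

section
/- Let (X,d) be a metric space, K ∈ ℝ, and let f : X → (−∞,∞] be K-convex, i.e., every pair x₀, x₁ ∈ D[f] admits a minimal geodesic γ from x₀ to x₁ such that f(γ(t)) ≤ (1−t)f(x₀) + t·f(x₁) − (K/2)·t(1−t)·d(x₀,x₁)² for all t ∈ [0,1]. Then f is (K,N)-convex for every N < 0. -/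
open Real

/-- A minimal (constant-speed, minimizing) geodesic parametrized on `[0,1]`. -/
def IsMinGeodesic {X : Type*} [MetricSpace X] (γ : ℝ → X) : Prop :=
  ∀ s ∈ Set.Icc (0:ℝ) 1, ∀ t ∈ Set.Icc (0:ℝ) 1,
    dist (γ s) (γ t) = |s - t| * dist (γ 0) (γ 1)

/-- Exponential of an extended real, valued in `ℝ≥0∞`. -/
noncomputable def erexp (x : EReal) : ENNReal :=
  if x = ⊤ then ⊤ else if x = ⊥ then 0 else ENNReal.ofReal (Real.exp x.toReal)

/-- The function `f_N = exp(-f/N)`, valued in `ℝ≥0∞`. -/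
noncomputable def efN {X : Type*} (N : ℝ) (f : X → EReal) (x : X) : ENNReal :=
  erexp (f x * ((-1 / N : ℝ) : EReal))

/-- `(K,N)`-convexity for `N < 0` of a function `f : X → (-∞,∞]`. -/
def KNConvex {X : Type*} [MetricSpace X] (K N : ℝ) (f : X → EReal) : Prop :=
  ∀ x₀ x₁ : X, f x₀ ≠ ⊤ → f x₁ ≠ ⊤ →
    (K < 0 → dist x₀ x₁ < π * Real.sqrt (N / K)) →
    ∃ γ : ℝ → X, IsMinGeodesic γ ∧ γ 0 = x₀ ∧ γ 1 = x₁ ∧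
      ∀ t ∈ Set.Icc (0:ℝ) 1,
        efN N f (γ t) ≤ ENNReal.ofReal (sg (K / N) (1 - t) (dist x₀ x₁)) * efN N f x₀
          + ENNReal.ofReal (sg (K / N) t (dist x₀ x₁)) * efN N f x₁

/-- `K`-convexity of a function `f : X → (-∞,∞]` on a metric space. -/
def KConvex {X : Type*} [MetricSpace X] (K : ℝ) (f : X → EReal) : Prop :=
  ∀ x₀ x₁ : X, f x₀ ≠ ⊤ → f x₁ ≠ ⊤ →
    ∃ γ : ℝ → X, IsMinGeodesic γ ∧ γ 0 = x₀ ∧ γ 1 = x₁ ∧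
      ∀ t ∈ Set.Icc (0:ℝ) 1,
        f (γ t) ≤ (((1 - t) * (f x₀).toReal + t * (f x₁).toReal
          - K / 2 * (t * (1 - t)) * (dist x₀ x₁) ^ 2 : ℝ) : EReal)


lemma aux_cmp (s c : ℝ → ℝ) (κ d a p : ℝ)
    (hs : ∀ x, HasDerivAt s (c x) x) (hc : ∀ x, HasDerivAt c (-κ * s x) x)
    (hs0 : s 0 = 0) (hc0 : c 0 = 1) (hpos : ∀ x, 0 ≤ x → x ≤ d → 0 ≤ s x)
    (hadd : ∀ x, s d = c x * s (d - x) + s x * c (d - x))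
    (x : ℝ) (hx0 : 0 ≤ x) (hxd : x ≤ d) :
    exp (a + p * x + κ / 2 * (x * (d - x))) * s d ≤ s (d - x) * exp a + s x * exp (a + p * d) := by
  set u : ℝ → ℝ := fun y => a + p * y + κ / 2 * (y * (d - y)) with hu
  set v : ℝ → ℝ := fun y => p + κ / 2 * (d - 2 * y) with hv
  have du : ∀ y, HasDerivAt u (v y) y := by
    intro y
    have := (((hasDerivAt_id y).const_mul p).const_add a).add
      (((hasDerivAt_id y).mul ((hasDerivAt_id y).const_sub d)).const_mul (κ / 2))
    refine this.congr_deriv ?_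
    simp only [hv, id]; ring
  have dv : ∀ y, HasDerivAt v (-κ) y := by
    intro y
    have := ((((hasDerivAt_id y).const_mul 2).const_sub d).const_mul (κ / 2)).const_add p
    refine this.congr_deriv ?_
    ring
  have dh : ∀ y, HasDerivAt (fun y => exp (u y)) (exp (u y) * v y) y := fun y => (du y).exp
  have dh' : ∀ y, HasDerivAt (fun y => exp (u y) * v y)
      (exp (u y) * (v y) ^ 2 - κ * exp (u y)) y := by
    intro y
    refine ((dh y).mul (dv y)).congr_deriv ?_
    ring
  have dsr : ∀ y, HasDerivAt (fun y => s (d - y)) (- c (d - y)) y := by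
    intro y
    have := (hs (d - y)).comp y ((hasDerivAt_id y).const_sub d)
    refine this.congr_deriv ?_
    simp
  have dcr : ∀ y, HasDerivAt (fun y => c (d - y)) (κ * s (d - y)) y := by
    intro y
    have := (hc (d - y)).comp y ((hasDerivAt_id y).const_sub d)
    refine this.congr_deriv ?_
    simp
  have d1 : ∀ y, HasDerivAt (fun y => exp (u y) * v y * s y - exp (u y) * c y)
      (exp (u y) * (v y) ^ 2 * s y) y := by
    intro y
    refine (((dh' y).mul (hs y)).sub ((dh y).mul (hc y))).congr_deriv ?_
    ring
  have d2 : ∀ y, HasDerivAt (fun y => exp (u y) * v y * s (d - y) + exp (u y) * c (d - y))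
      (exp (u y) * (v y) ^ 2 * s (d - y)) y := by
    intro y
    refine (((dh' y).mul (dsr y)).add ((dh y).mul (dcr y))).congr_deriv ?_
    ring
  have m1 : MonotoneOn (fun y => exp (u y) * v y * s y - exp (u y) * c y) (Set.Icc 0 d) := by
    refine monotoneOn_of_hasDerivWithinAt_nonneg (convex_Icc _ _)
      (fun y _ => (d1 y).continuousAt.continuousWithinAt)
      (fun y _ => (d1 y).hasDerivWithinAt) ?_
    intro y hy
    have hy := interior_subset hy
    have := hpos y hy.1 hy.2
    positivity
  have m2 : MonotoneOn (fun y => exp (u y) * v y * s (d - y) + exp (u y) * c (d - y))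
      (Set.Icc 0 d) := by
    refine monotoneOn_of_hasDerivWithinAt_nonneg (convex_Icc _ _)
      (fun y _ => (d2 y).continuousAt.continuousWithinAt)
      (fun y _ => (d2 y).hasDerivWithinAt) ?_
    intro y hy
    have hy := interior_subset hy
    have := hpos (d - y) (by linarith [hy.2]) (by linarith [hy.1])
    positivity
  have hd : 0 ≤ d := hx0.trans hxd
  have i1 := m1 ⟨le_rfl, hd⟩ ⟨hx0, hxd⟩ hx0
  have i2 := m2 ⟨hx0, hxd⟩ ⟨hd, le_rfl⟩ hxd
  have u0 : u 0 = a := by simp [hu]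
  have ud : u d = a + p * d := by simp [hu]
  simp only [u0, ud, hs0, hc0, sub_self, mul_zero, mul_one, zero_sub, zero_add] at i1 i2
  have p1 := hpos x hx0 hxd
  have p2 := hpos (d - x) (by linarith) (by linarith)
  have j1 := mul_le_mul_of_nonneg_left i1 p2
  have j2 := mul_le_mul_of_nonneg_left i2 p1
  change exp (u x) * s d ≤ _
  rw [hadd x]
  linarith

lemma aux_sk (κ d a p : ℝ) (hd : 0 < d) (hκ : 0 < κ → √κ * d < π) :
    (∀ x, 0 ≤ x → x ≤ d → 0 ≤ sk κ x) ∧ 0 < sk κ d ∧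
    ∀ x, 0 ≤ x → x ≤ d → exp (a + p * x + κ / 2 * (x * (d - x))) * sk κ d
      ≤ sk κ (d - x) * exp a + sk κ x * exp (a + p * d) := by
  rcases lt_trichotomy 0 κ with h | h | h
  · have e : sk κ = fun x => sin (√κ * x) / √κ := by funext x; simp [sk, h]
    have hq : 0 < √κ := sqrt_pos.2 h
    have hqq : √κ * √κ = κ := mul_self_sqrt h.le
    have hpos : ∀ x, 0 ≤ x → x ≤ d → 0 ≤ sk κ x := by
      intro x h0 h1
      rw [e]
      refine div_nonneg (sin_nonneg_of_nonneg_of_le_pi (by positivity) ?_) hq.le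
      exact (mul_le_mul_of_nonneg_left h1 hq.le).trans (hκ h).le
    refine ⟨hpos, ?_, ?_⟩
    · rw [e]
      exact div_pos (sin_pos_of_pos_of_lt_pi (by positivity) (hκ h)) hq
    · refine aux_cmp (sk κ) (fun x => cos (√κ * x)) κ d a p ?_ ?_ ?_ ?_ hpos ?_
      · intro x
        rw [e]
        refine ((((hasDerivAt_id x).const_mul √κ).sin).div_const √κ).congr_deriv ?_
        simp; field_simp
      · intro x
        rw [e]
        refine (((hasDerivAt_id x).const_mul √κ).cos).congr_deriv ?_
        simp only [id]
        nth_rw 3 [← hqq]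
        field_simp
      · simp [e]
      · simp
      · intro x
        simp only [e]
        have : √κ * d = √κ * x + √κ * (d - x) := by ring
        rw [this, sin_add]
        ring
  · subst h
    have e : sk 0 = fun x => x := by funext x; simp [sk]
    have hpos : ∀ x, 0 ≤ x → x ≤ d → 0 ≤ sk 0 x := by
      intro x h0 h1
      rw [e]; exact h0
    refine ⟨hpos, by rw [e]; exact hd, ?_⟩
    refine aux_cmp (sk 0) (fun x => 1) 0 d a p ?_ ?_ ?_ ?_ hpos ?_
    · intro x; rw [e]; exact hasDerivAt_id x
    · intro x; simpa using hasDerivAt_const x (1:ℝ)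
    · simp [e]
    · simp
    · intro x; simp [e]
  · have e : sk κ = fun x => sinh (√(-κ) * x) / √(-κ) := by
      funext x; simp [sk, h.not_gt, h.ne]
    have hq : 0 < √(-κ) := sqrt_pos.2 (by linarith)
    have hqq : √(-κ) * √(-κ) = -κ := mul_self_sqrt (by linarith)
    have hpos : ∀ x, 0 ≤ x → x ≤ d → 0 ≤ sk κ x := by
      intro x h0 h1
      rw [e]
      exact div_nonneg (sinh_nonneg_iff.2 (by positivity)) hq.le
    refine ⟨hpos, ?_, ?_⟩
    · rw [e]
      exact div_pos (sinh_pos_iff.2 (by positivity)) hq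
    · refine aux_cmp (sk κ) (fun x => cosh (√(-κ) * x)) κ d a p ?_ ?_ ?_ ?_ hpos ?_
      · intro x
        rw [e]
        refine ((((hasDerivAt_id x).const_mul √(-κ)).sinh).div_const √(-κ)).congr_deriv ?_
        simp; field_simp
      · intro x
        rw [e]
        refine (((hasDerivAt_id x).const_mul √(-κ)).cosh).congr_deriv ?_
        simp only [id]
        nth_rw 3 [← hqq]
        field_simp
      · simp [e]
      · simp
      · intro x
        simp only [e]
        have : √(-κ) * d = √(-κ) * x + √(-κ) * (d - x) := by ring
        rw [this, sinh_add]
        ring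

lemma aux_efN {X : Type*} (N : ℝ) (f : X → EReal) (x : X) (h1 : f x ≠ ⊤) (h2 : f x ≠ ⊥) :
    efN N f x = ENNReal.ofReal (exp ((f x).toReal * (-1 / N))) := by
  unfold efN
  rw [← EReal.coe_toReal h1 h2, ← EReal.coe_mul]
  simp only [erexp, EReal.coe_ne_top, EReal.coe_ne_bot, if_false, EReal.toReal_coe]

lemma aux_real (κ d a b t : ℝ) (hd : 0 ≤ d) (hκ : 0 < κ → √κ * d < π) (hab : d = 0 → a = b)
    (ht0 : 0 ≤ t) (ht1 : t ≤ 1) :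
    0 ≤ sg κ (1 - t) d ∧ 0 ≤ sg κ t d ∧
    exp ((1 - t) * a + t * b + κ / 2 * (t * (1 - t)) * d ^ 2)
      ≤ sg κ (1 - t) d * exp a + sg κ t d * exp b := by
  rcases hd.eq_or_lt with h | h
  · subst h
    obtain rfl := hab rfl
    simp only [sg, if_true]
    refine ⟨by linarith, ht0, ?_⟩
    apply le_of_eq
    have : (1 - t) * a + t * a + κ / 2 * (t * (1 - t)) * 0 ^ 2 = a := by ring
    rw [this]; ring
  · obtain ⟨hp, hdp, hc⟩ := aux_sk κ d a ((b - a) / d) h hκ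
    have k1 : t * d ≤ d := by nlinarith
    have k0 : 0 ≤ t * d := by positivity
    have k2 : (1 - t) * d = d - t * d := by ring
    have hc := hc (t * d) k0 k1
    simp only [sg, h.ne', if_false]
    refine ⟨div_nonneg (hp _ (by linarith) (by linarith)) hdp.le,
      div_nonneg (hp _ k0 k1) hdp.le, ?_⟩
    have e1 : a + (b - a) / d * (t * d) + κ / 2 * (t * d * (d - t * d))
        = (1 - t) * a + t * b + κ / 2 * (t * (1 - t)) * d ^ 2 := by
      field_simp; ring
    have e2 : a + (b - a) / d * d = b := by field_simp; ring
    rw [e1, e2] at hc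
    rw [k2, div_mul_eq_mul_div (sk κ (d - t * d)), div_mul_eq_mul_div (sk κ (t * d)), ← add_div,
      le_div_iff₀ hdp]
    exact hc

theorem stmt_8 {X : Type*} [MetricSpace X] (K : ℝ)
    (f : X → EReal) (hbot : ∀ x, f x ≠ ⊥) (hf : KConvex K f) :
    ∀ N : ℝ, N < 0 → KNConvex K N f := by
  intro N hN x₀ x₁ h0 h1 hd
  obtain ⟨γ, hγ, g0, g1, hle⟩ := hf x₀ x₁ h0 h1
  refine ⟨γ, hγ, g0, g1, ?_⟩
  intro t ht
  have hle := hle t ht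
  have htop : f (γ t) ≠ ⊤ := fun h => by
    rw [h] at hle; exact EReal.coe_ne_top _ (top_le_iff.1 hle)
  rw [← EReal.coe_toReal htop (hbot _), EReal.coe_le_coe_iff] at hle
  have hκ : 0 < K / N → √(K / N) * dist x₀ x₁ < π := by
    intro h
    have hK : K < 0 := by
      by_contra hK
      exact absurd h (not_lt.2 (div_nonpos_of_nonneg_of_nonpos (not_lt.1 hK) hN.le))
    have hd := hd hK
    have hq : 0 < √(K / N) := sqrt_pos.2 h
    rw [← inv_div K N, sqrt_inv, ← div_eq_mul_inv, lt_div_iff₀ hq] at hd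
    linarith
  obtain ⟨s0, s1, hr⟩ := aux_real (K / N) (dist x₀ x₁) ((f x₀).toReal * (-1 / N))
    ((f x₁).toReal * (-1 / N)) t dist_nonneg hκ (fun h => by rw [dist_eq_zero.1 h]) ht.1 ht.2
  rw [aux_efN N f _ htop (hbot _), aux_efN N f _ h0 (hbot _), aux_efN N f _ h1 (hbot _),
    ← ENNReal.ofReal_mul s0, ← ENNReal.ofReal_mul s1,
    ← ENNReal.ofReal_add (by positivity) (by positivity)]
  refine ENNReal.ofReal_le_ofReal (le_trans (exp_le_exp.2 ?_) hr)
  have hN' : 0 ≤ -1 / N := div_nonneg_of_nonpos (by norm_num) hN.le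
  refine (mul_le_mul_of_nonneg_right hle hN').trans (le_of_eq ?_)
  ring
end

section
/- Let K ∈ ℝ, d ≥ 0, a, b ∈ ℝ and t ∈ [0,1]. Then the limit as ε → 0⁺ of (1/ε)·log( σ_{−K}^{(1−t)}(√ε·d)·exp(ε·a) + σ_{−K}^{(t)}(√ε·d)·exp(ε·b) ) exists and equals (1−t)·a + t·b − (K/2)·t(1−t)·d² (the expressions being defined for all sufficiently small ε > 0). -/
open Real

lemma sinh_bd {x : ℝ} (hx : |x| ≤ 1) : |Real.sinh x - (x + x ^ 3 / 6)| ≤ |x| ^ 4 * (5 / 96) := by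
  have h1 := Real.exp_bound hx (n := 4) (by norm_num)
  have h2 := Real.exp_bound (x := -x) (by rwa [abs_neg]) (n := 4) (by norm_num)
  rw [abs_neg] at h2
  norm_num [Finset.sum_range_succ, Nat.factorial] at h1 h2
  rw [Real.sinh_eq]
  rw [abs_le] at h1 h2 ⊢
  have e : |x| ^ 4 = x ^ 4 := by
    rw [← abs_pow, abs_of_nonneg (by positivity)]
  rw [e] at h1 h2 ⊢
  constructor <;> ring_nf at * <;> linarith [h1.1, h1.2, h2.1, h2.2]

lemma sk_bd (κ : ℝ) : ∃ C δ : ℝ, 0 < δ ∧ ∀ y : ℝ, 0 < y → y ≤ δ →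
    |sk κ y - (y - κ * y ^ 3 / 6)| ≤ C * y ^ 4 := by
  rcases lt_trichotomy κ 0 with h | h | h
  · have hc : 0 < √(-κ) := Real.sqrt_pos.2 (by linarith)
    have hs : √(-κ) ^ 2 = -κ := Real.sq_sqrt (by linarith)
    have hk : ∀ y, sk κ y = Real.sinh (√(-κ) * y) / √(-κ) := fun y => by
      simp [sk, h.not_gt, h.ne]
    generalize √(-κ) = c at *
    refine ⟨c ^ 3 * (5 / 96), 1 / c, by positivity, fun y hy hy1 => ?_⟩
    have hcy : |c * y| = c * y := abs_of_pos (by positivity)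
    have hb := sinh_bd (x := c * y) (by rw [hcy]; rw [le_div_iff₀ hc] at hy1; linarith)
    rw [hcy] at hb
    rw [hk]
    have e : Real.sinh (c * y) / c - (y - κ * y ^ 3 / 6)
        = (Real.sinh (c * y) - (c * y + (c * y) ^ 3 / 6)) / c := by
      have : κ = - c ^ 2 := by linarith
      subst this
      field_simp
      ring
    rw [e, abs_div, abs_of_pos hc, div_le_iff₀ hc]
    refine hb.trans (le_of_eq (by ring))
  · exact ⟨0, 1, one_pos, fun y _ _ => by simp [sk, h]⟩
  · have hc : 0 < √κ := Real.sqrt_pos.2 h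
    have hs : √κ ^ 2 = κ := Real.sq_sqrt h.le
    have hk : ∀ y, sk κ y = Real.sin (√κ * y) / √κ := fun y => by
      simp [sk, h]
    generalize √κ = c at *
    refine ⟨c ^ 3 * (5 / 96), 1 / c, by positivity, fun y hy hy1 => ?_⟩
    have hcy : |c * y| = c * y := abs_of_pos (by positivity)
    have hb := Real.sin_bound (x := c * y) (by rw [hcy]; rw [le_div_iff₀ hc] at hy1; linarith)
    rw [hcy] at hb
    rw [hk]
    have e : Real.sin (c * y) / c - (y - κ * y ^ 3 / 6)
        = (Real.sin (c * y) - (c * y - (c * y) ^ 3 / 6)) / c := by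
      subst hs
      field_simp
    have hp : 0 ≤ (c * y) ^ 4 := by positivity
    rw [e, abs_div, abs_of_pos hc, div_le_iff₀ hc]
    refine hb.trans ?_
    have h1 : c * y ≤ 1 := by rw [le_div_iff₀ hc] at hy1; linarith
    have h2 : (c * y) ^ 4 * (c * y) ≤ (c * y) ^ 4 * 1 := mul_le_mul_of_nonneg_left h1 hp
    have h3 : c ^ 3 * (5 / 96) * y ^ 4 * c = (c * y) ^ 4 * (5 / 96) := by ring
    rw [h3]
    nlinarith [h2, hp]

/-- normalized comparison function in the squared variable -/
noncomputable def sS (κ x : ℝ) : ℝ := if x = 0 then 1 else sk κ (√x) / √x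

lemma sS_deriv (κ : ℝ) : HasDerivWithinAt (sS κ) (-κ / 6) (Set.Ici 0) 0 := by
  rw [hasDerivWithinAt_iff_tendsto_slope, Set.Ici_sdiff_left]
  obtain ⟨C, δ, hδ, hb⟩ := sk_bd κ
  rw [tendsto_iff_norm_sub_tendsto_zero]
  have hlim : Filter.Tendsto (fun x : ℝ => C * √x) (nhdsWithin 0 (Set.Ioi 0)) (nhds 0) := by
    have : Filter.Tendsto (fun x : ℝ => C * √x) (nhds 0) (nhds (C * √0)) :=
      (by fun_prop : Continuous (fun x : ℝ => C * √x)).tendsto 0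
    simp only [Real.sqrt_zero, mul_zero] at this
    exact this.mono_left nhdsWithin_le_nhds
  refine squeeze_zero' (Filter.Eventually.of_forall fun _ => norm_nonneg _) ?_ hlim
  filter_upwards [Ioo_mem_nhdsGT (show (0:ℝ) < δ ^ 2 by positivity)] with x hx
  have hy : 0 < √x := Real.sqrt_pos.2 hx.1
  have hyδ : √x ≤ δ := Real.sqrt_le_iff.2 ⟨hδ.le, hx.2.le⟩
  have h := hb _ hy hyδ
  have hs : x = √x ^ 2 := (Real.sq_sqrt hx.1.le).symm
  rw [slope_def_field, Real.norm_eq_abs]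
  simp only [sS, hx.1.ne', if_true, if_false]
  generalize √x = y at *
  subst hs
  have e : (sk κ y / y - 1) / (y ^ 2 - 0) - -κ / 6 = (sk κ y - (y - κ * y ^ 3 / 6)) / y ^ 3 := by
    field_simp
    ring
  rw [e, abs_div, abs_of_pos (pow_pos hy 3), div_le_iff₀ (by positivity)]
  exact h.trans (le_of_eq (by ring))

lemma sg_eq (κ t d ε : ℝ) (hd : 0 ≤ d) (ht : 0 ≤ t) (hε : 0 ≤ ε) :
    sg κ t (√ε * d) = t * sS κ (t ^ 2 * d ^ 2 * ε) / sS κ (d ^ 2 * ε) := by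
  have e1 : √(d ^ 2 * ε) = √ε * d := by
    rw [Real.sqrt_mul (by positivity), Real.sqrt_sq hd, mul_comm]
  have e2 : √(t ^ 2 * d ^ 2 * ε) = t * (√ε * d) := by
    rw [mul_assoc, Real.sqrt_mul (by positivity), Real.sqrt_sq ht, e1]
  have z1 : d ^ 2 * ε = 0 ↔ √ε * d = 0 := by
    rw [← e1, Real.sqrt_eq_zero (by positivity)]
  have z2 : t ^ 2 * d ^ 2 * ε = 0 ↔ t * (√ε * d) = 0 := by
    rw [← e2, Real.sqrt_eq_zero (by positivity)]
  simp only [sg, sS, e1, e2, z1, z2]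
  generalize √ε * d = θ
  by_cases h : θ = 0
  · simp [h]
  · by_cases h' : t = 0
    · simp [h, h', sk]
    · have : t * θ ≠ 0 := mul_ne_zero h' h
      simp only [h, this, if_false]
      field_simp

lemma sg_deriv (κ t d : ℝ) (hd : 0 ≤ d) (ht : 0 ≤ t) :
    HasDerivWithinAt (fun ε => sg κ t (√ε * d)) (κ / 6 * (t * (1 - t ^ 2)) * d ^ 2)
      (Set.Ici 0) 0 := by
  have h : ∀ c : ℝ, 0 ≤ c → HasDerivWithinAt (fun ε => sS κ (c * ε)) (-κ / 6 * c) (Set.Ici 0) 0 := by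
    intro c hc
    have h1 : HasDerivWithinAt (fun ε : ℝ => c * ε) c (Set.Ici 0) 0 := by
      simpa using (hasDerivWithinAt_id (0:ℝ) (Set.Ici 0)).const_mul c
    exact HasDerivWithinAt.comp_of_eq (0:ℝ) (sS_deriv κ) h1
      (fun x hx => mul_nonneg hc hx) (by simp)
  have s0 : sS κ 0 = 1 := by simp [sS]
  have := ((h (t ^ 2 * d ^ 2) (by positivity)).const_mul t).div (h (d ^ 2) (by positivity))
    (by simp [s0])
  refine (this.congr_deriv ?_).congr (fun ε hε => sg_eq κ t d ε hd ht hε)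
    (sg_eq κ t d 0 hd ht le_rfl)
  simp [s0]
  ring

theorem stmt_9 (K d a b t : ℝ) (hd : 0 ≤ d) (ht : t ∈ Set.Icc (0:ℝ) 1) :
    Filter.Tendsto
      (fun ε : ℝ => (1 / ε) *
        Real.log (sg (-K) (1 - t) (Real.sqrt ε * d) * Real.exp (ε * a)
          + sg (-K) t (Real.sqrt ε * d) * Real.exp (ε * b)))
      (nhdsWithin 0 (Set.Ioi 0))
      (nhds ((1 - t) * a + t * b - K / 2 * (t * (1 - t)) * d ^ 2)) := by
  obtain ⟨h0, h1⟩ := ht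
  have hE : ∀ c : ℝ, HasDerivWithinAt (fun ε : ℝ => Real.exp (ε * c)) c (Set.Ici 0) 0 := by
    intro c
    simpa using (((hasDerivAt_id (0:ℝ)).mul_const c).exp).hasDerivWithinAt (s := Set.Ici 0)
  have H := (((sg_deriv (-K) (1 - t) d hd (by linarith)).mul (hE a)).add
    ((sg_deriv (-K) t d hd h0).mul (hE b))).log (by simp [sg])
  rw [hasDerivWithinAt_iff_tendsto_slope, Set.Ici_sdiff_left] at H
  refine (H.congr fun ε => ?_).trans (le_of_eq ?_)
  · simp [slope_def_field, sg]
    ring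
  · congr 1
    simp [sg]
    ring
end

section
/- Let (X,d) be a metric space, K ∈ ℝ, N < 0, L ≥ 0, and let f : X → ℝ be L-Lipschitz and strongly (K,N)-convex. Then f is (K + L²/N)-convex along every minimal geodesic: for every minimal geodesic γ : [0,1] → X and every t ∈ [0,1], f(γ(t)) ≤ (1−t)·f(γ(0)) + t·f(γ(1)) − ((K + L²/N)/2)·t(1−t)·d(γ(0),γ(1))². -/
open Real

theorem aux_sg (κ θ : ℝ) (hθ : 0 < θ) (hq : κ * θ ^ 2 / 8 < 1) :
    sg κ (1 / 2) θ ≤ 1 / (2 * (1 - κ * θ ^ 2 / 8)) := by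
  unfold sg sk
  rw [if_neg hθ.ne']
  rcases lt_trichotomy κ 0 with hκ | hκ | hκ
  · rw [if_neg hκ.not_gt, if_neg hκ.ne, if_neg hκ.not_gt, if_neg hκ.ne]
    have hs : 0 < Real.sqrt (-κ) := Real.sqrt_pos.2 (by linarith)
    have hs2 : Real.sqrt (-κ) ^ 2 = -κ := Real.sq_sqrt (by linarith)
    set r := Real.sqrt (-κ) with hr
    set y := r * (1 / 2 * θ) with hy
    have hy0 : 0 < y := by positivity
    have h2 : r * θ = 2 * y := by rw [hy]; ring
    have hsy : 0 < Real.sinh y := Real.sinh_pos_iff.2 hy0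
    have hc : 1 + y ^ 2 / 2 ≤ Real.cosh y := by
      have e1 : Real.cosh y = 1 + 2 * Real.sinh (y / 2) ^ 2 := by
        have := Real.cosh_two_mul (y / 2)
        rw [show 2 * (y / 2) = y by ring, Real.cosh_sq] at this
        linarith
      have e2 : y / 2 ≤ Real.sinh (y / 2) := Real.self_le_sinh_iff.2 (by positivity)
      have e3 : (y / 2) ^ 2 ≤ Real.sinh (y / 2) ^ 2 := by gcongr
      rw [e1]; nlinarith
    have hyq : 1 - κ * θ ^ 2 / 8 = 1 + y ^ 2 / 2 := by
      rw [hy, mul_pow, hs2]; ring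
    rw [h2, Real.sinh_two_mul, hyq]
    have : Real.sinh y / r / (2 * Real.sinh y * Real.cosh y / r) = 1 / (2 * Real.cosh y) := by
      field_simp
    rw [this]
    gcongr
  · subst hκ
    simp
    field_simp
    norm_num
  · rw [if_pos hκ, if_pos hκ]
    have hs : 0 < Real.sqrt κ := Real.sqrt_pos.2 hκ
    have hs2 : Real.sqrt κ ^ 2 = κ := Real.sq_sqrt hκ.le
    set r := Real.sqrt κ with hr
    set y := r * (1 / 2 * θ) with hy
    have hy0 : 0 < y := by positivity
    have h2 : r * θ = 2 * y := by rw [hy]; ring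
    have hyq : 1 - κ * θ ^ 2 / 8 = 1 - y ^ 2 / 2 := by
      rw [hy, mul_pow, hs2]; ring
    have hq' : 0 < 1 - y ^ 2 / 2 := by rw [← hyq]; linarith
    have hsy : 0 < Real.sin y := by
      apply Real.sin_pos_of_pos_of_lt_pi hy0
      nlinarith [Real.pi_gt_three]
    have hc : 1 - y ^ 2 / 2 ≤ Real.cos y := Real.one_sub_sq_div_two_le_cos
    have hc0 : 0 < Real.cos y := by linarith
    rw [h2, Real.sin_two_mul, hyq]
    have : Real.sin y / r / (2 * Real.sin y * Real.cos y / r) = 1 / (2 * Real.cos y) := by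
      field_simp
    rw [this]
    gcongr

theorem aux_log (n q w a b m : ℝ) (hn : 0 < n) (hq : 0 < q) (hab : |a - b| ≤ 2 * w)
    (h : Real.exp (m / n) ≤ 1 / (2 * q) * (Real.exp (a / n) + Real.exp (b / n))) :
    2 * n * (1 - q⁻¹) - w ^ 2 / n ≤ a + b - 2 * m := by
  have e1 : Real.exp (a / n) + Real.exp (b / n)
      = 2 * (Real.exp ((a + b) / (2 * n)) * Real.cosh ((a - b) / (2 * n))) := by
    rw [Real.cosh_eq, mul_div_assoc', mul_add, ← Real.exp_add, ← Real.exp_add]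
    rw [show (a + b) / (2 * n) + (a - b) / (2 * n) = a / n by field_simp; ring,
      show (a + b) / (2 * n) + -((a - b) / (2 * n)) = b / n by field_simp; ring]
    ring
  have e2 := Real.cosh_le_exp_half_sq ((a - b) / (2 * n))
  have e3 : Real.exp (m / n) ≤
      Real.exp (-Real.log q + ((a + b) / (2 * n) + ((a - b) / (2 * n)) ^ 2 / 2)) := by
    rw [Real.exp_add, Real.exp_add, Real.exp_neg, Real.exp_log hq]
    refine h.trans ?_
    rw [e1]
    have : 1 / (2 * q) * (2 * (Real.exp ((a + b) / (2 * n)) * Real.cosh ((a - b) / (2 * n))))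
      = q⁻¹ * (Real.exp ((a + b) / (2 * n)) * Real.cosh ((a - b) / (2 * n))) := by
      field_simp
    rw [this]
    gcongr
  have e4 := Real.exp_le_exp.1 e3
  have e5 := Real.one_sub_inv_le_log_of_pos hq
  have e6 : (a - b) ^ 2 ≤ (2 * w) ^ 2 := sq_le_sq' (by linarith [(abs_le.1 hab).1]) (abs_le.1 hab).2
  have e7 : m ≤ n * (-(1 - q⁻¹)) + (a + b) / 2 + (a - b) ^ 2 / (8 * n) := by
    have : m / n ≤ -(1 - q⁻¹) + ((a + b) / (2 * n) + ((a - b) / (2 * n)) ^ 2 / 2) := by linarith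
    rw [div_le_iff₀ hn] at this
    refine this.trans (le_of_eq ?_)
    field_simp
    ring
  have e8 : (a - b) ^ 2 / (8 * n) ≤ (2 * w) ^ 2 / (8 * n) := by gcongr
  have e9 : (2 * w) ^ 2 / (8 * n) = w ^ 2 / n / 2 := by field_simp; ring
  linarith

theorem aux_max (F : ℝ → ℝ) (C : ℝ) (hF : ContinuousOn F (Set.Icc 0 1))
    (h : ∀ s ∈ Set.Ioo (0:ℝ) 1, ∀ ε > 0, ∀ᶠ h in nhdsWithin (0:ℝ) (Set.Ioi 0),
      (C - ε) * h ^ 2 ≤ F (s - h) + F (s + h) - 2 * F s) :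
    ∀ t ∈ Set.Icc (0:ℝ) 1, F t ≤ (1 - t) * F 0 + t * F 1 - C / 2 * (t * (1 - t)) := by
  intro t ht
  by_contra! hcon
  obtain ⟨ε, hε, hε'⟩ : ∃ ε > 0,
      ε < F t - ((1 - t) * F 0 + t * F 1 - C / 2 * (t * (1 - t))) :=
    exists_between (by linarith)
  set v : ℝ → ℝ := fun x =>
    F x - ((1 - x) * F 0 + x * F 1 - C / 2 * (x * (1 - x))) - ε * (x * (1 - x)) with hv
  have hvc : ContinuousOn v (Set.Icc 0 1) := by
    apply ContinuousOn.sub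
    · exact hF.sub (by fun_prop)
    · fun_prop
  obtain ⟨s, hs, hmax⟩ := isCompact_Icc.exists_isMaxOn ⟨t, ht⟩ hvc
  have hvt : 0 < v t := by
    have : t * (1 - t) ≤ 1 := by nlinarith [ht.1, ht.2]
    simp only [hv]
    nlinarith
  have hvs : 0 < v s := hvt.trans_le (hmax ht)
  have hs0 : s ≠ 0 := by rintro rfl; simp [hv] at hvs
  have hs1 : s ≠ 1 := by rintro rfl; simp [hv] at hvs
  have hs' : s ∈ Set.Ioo (0:ℝ) 1 := ⟨lt_of_le_of_ne hs.1 hs0.symm, lt_of_le_of_ne hs.2 hs1⟩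
  have hsm : ∀ᶠ h in nhdsWithin (0:ℝ) (Set.Ioi 0), h ∈ Set.Ioo 0 (min s (1 - s)) :=
    Ioo_mem_nhdsGT (lt_min hs'.1 (by linarith [hs'.2]))
  obtain ⟨k, hk1, hk0, hk2⟩ := ((h s hs' ε hε).and hsm).exists
  have m1 : v (s - k) ≤ v s := hmax ⟨by linarith [min_le_left s (1 - s)], by linarith [hs.2]⟩
  have m2 : v (s + k) ≤ v s := hmax ⟨by linarith [hs.1], by linarith [min_le_right s (1 - s)]⟩
  simp only [hv] at m1 m2
  have : 0 < ε * k ^ 2 := by positivity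
  nlinarith

theorem stmt_11 {X : Type*} [MetricSpace X] (K N L : ℝ) (hN : N < 0) (hL : 0 ≤ L)
    (f : X → ℝ)
    (hLip : ∀ x y : X, |f x - f y| ≤ L * dist x y)
    (hconv : ∀ γ : ℝ → X, IsMinGeodesic γ →
      (K < 0 → dist (γ 0) (γ 1) < π * Real.sqrt (N / K)) →
      ∀ t ∈ Set.Icc (0:ℝ) 1,
        Real.exp (-f (γ t) / N)
          ≤ sg (K / N) (1 - t) (dist (γ 0) (γ 1)) * Real.exp (-f (γ 0) / N)
            + sg (K / N) t (dist (γ 0) (γ 1)) * Real.exp (-f (γ 1) / N)) :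
    ∀ γ : ℝ → X, IsMinGeodesic γ → ∀ t ∈ Set.Icc (0:ℝ) 1,
      f (γ t) ≤ (1 - t) * f (γ 0) + t * f (γ 1)
        - (K + L ^ 2 / N) / 2 * (t * (1 - t)) * (dist (γ 0) (γ 1)) ^ 2 := by
  intro γ hγ t ht
  set D := dist (γ 0) (γ 1) with hD
  have hD0 : 0 ≤ D := dist_nonneg
  have hn : 0 < -N := by linarith
  have hLF : ∀ s ∈ Set.Icc (0:ℝ) 1, ∀ r ∈ Set.Icc (0:ℝ) 1,
      |f (γ s) - f (γ r)| ≤ L * D * |s - r| := by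
    intro s hs r hr
    refine (hLip _ _).trans (le_of_eq ?_)
    rw [hγ s hs r hr]; ring
  have hcont : ContinuousOn (fun s => f (γ s)) (Set.Icc 0 1) := by
    have : LipschitzOnWith (Real.toNNReal (L * D)) (fun s => f (γ s)) (Set.Icc 0 1) := by
      apply LipschitzOnWith.of_dist_le_mul
      intro s hs r hr
      rw [Real.coe_toNNReal _ (by positivity), Real.dist_eq, Real.dist_eq]
      exact hLF s hs r hr
    exact this.continuousOn
  rcases hD0.eq_or_lt with hz | hDpos
  · have h0 := hLF t ht 0 (by simp)
    have h1 := hLF 0 (by simp) 1 (by simp)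
    rw [← hz] at h0 h1 ⊢
    simp only [mul_zero, zero_mul] at h0 h1
    have h0' := abs_nonpos_iff.1 h0
    have h1' := abs_nonpos_iff.1 h1
    have : f (γ 1) = f (γ 0) := by linarith
    rw [this]
    nlinarith
  have key := aux_max (fun s => f (γ s)) ((K + L ^ 2 / N) * D ^ 2) hcont ?_ t ht
  · linarith
  intro s hs ε hε
  have hsm : ∀ᶠ h in nhdsWithin (0:ℝ) (Set.Ioi 0), h ∈ Set.Ioo 0 (min s (1 - s)) :=
    Ioo_mem_nhdsGT (lt_min hs.1 (by linarith [hs.2]))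
  have hsmall : ∀ᶠ h in nhdsWithin (0:ℝ) (Set.Ioi 0),
      K < 0 → 2 * h * D < π * Real.sqrt (N / K) := by
    by_cases hK : K < 0
    · have hpos : 0 < π * Real.sqrt (N / K) :=
        mul_pos Real.pi_pos (Real.sqrt_pos.2 (div_pos_of_neg_of_neg hN hK))
      have hc : Filter.Tendsto (fun h : ℝ => 2 * h * D) (nhds 0) (nhds 0) := by
        have : Continuous (fun h : ℝ => 2 * h * D) := by fun_prop
        simpa using this.tendsto 0
      filter_upwards [nhdsWithin_le_nhds (hc.eventually (gt_mem_nhds hpos))] with h hh _ using hh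
    · exact Filter.Eventually.of_forall fun h hK' => absurd hK' hK
  have hq : Filter.Tendsto (fun h : ℝ => 1 - K / N * (2 * h * D) ^ 2 / 8) (nhds 0) (nhds 1) := by
    have : Continuous (fun h : ℝ => 1 - K / N * (2 * h * D) ^ 2 / 8) := by fun_prop
    simpa using this.tendsto 0
  have hq0 := nhdsWithin_le_nhds (s := Set.Ioi 0) (hq.eventually (lt_mem_nhds one_pos))
  have hqK : Filter.Tendsto (fun h : ℝ => K * D ^ 2 * (1 - K / N * (2 * h * D) ^ 2 / 8)⁻¹)
      (nhds 0) (nhds (K * D ^ 2)) := by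
    simpa using (hq.inv₀ one_ne_zero).const_mul (K * D ^ 2)
  have hqe := nhdsWithin_le_nhds (s := Set.Ioi 0)
    (hqK.eventually (lt_mem_nhds (show K * D ^ 2 - ε < K * D ^ 2 by linarith)))
  filter_upwards [hsm, hsmall, hq0, hqe] with h hh1 hh2 hh3 hh4
  obtain ⟨hpos, hlt⟩ := hh1
  have hl := min_le_left s (1 - s)
  have hr := min_le_right s (1 - s)
  have hmem : ∀ r ∈ Set.Icc (0:ℝ) 1, s - h + 2 * h * r ∈ Set.Icc (0:ℝ) 1 := by
    intro r hr'
    have h1 : 0 ≤ 2 * h * r := mul_nonneg (by linarith) hr'.1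
    have h2 : 2 * h * r ≤ 2 * h * 1 := mul_le_mul_of_nonneg_left hr'.2 (by linarith)
    exact ⟨by linarith, by linarith⟩
  set η : ℝ → X := fun r => γ (s - h + 2 * h * r) with hη
  have hηd : ∀ x ∈ Set.Icc (0:ℝ) 1, ∀ y ∈ Set.Icc (0:ℝ) 1,
      dist (η x) (η y) = |x - y| * (2 * h * D) := by
    intro x hx y hy
    simp only [hη]
    rw [hγ _ (hmem x hx) _ (hmem y hy),
      show s - h + 2 * h * x - (s - h + 2 * h * y) = 2 * h * (x - y) by ring, abs_mul,
      abs_of_pos (show 0 < 2 * h by linarith)]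
    ring
  have hη01 : dist (η 0) (η 1) = 2 * h * D := by
    rw [hηd 0 (by simp) 1 (by simp)]; simp
  have hηg : IsMinGeodesic η := by
    intro x hx y hy
    rw [hηd x hx y hy, hη01]
  have hc := hconv η hηg (by rw [hη01]; exact hh2) (1 / 2) (by norm_num)
  rw [hη01] at hc
  have e0 : η 0 = γ (s - h) := by simp [hη]
  have e1 : η 1 = γ (s + h) := by simp only [hη]; congr 1; ring
  have e2 : η (1 / 2) = γ s := by simp only [hη]; congr 1; ring
  rw [e0, e1, e2, show (1:ℝ) - 1 / 2 = 1 / 2 by norm_num, ← mul_add] at hc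
  have hsg := aux_sg (K / N) (2 * h * D) (by positivity) (by linarith)
  have hab := hLF (s - h) ⟨by linarith, by linarith [hs.2]⟩ (s + h) ⟨by linarith [hs.1], by linarith⟩
  rw [show s - h - (s + h) = -(2 * h) by ring, abs_neg,
    abs_of_pos (show 0 < 2 * h by linarith)] at hab
  set q := 1 - K / N * (2 * h * D) ^ 2 / 8 with hqdef
  have hfin := aux_log (-N) q (L * D * h) (f (γ (s - h))) (f (γ (s + h))) (f (γ s)) hn hh3
    (by linarith) (by
      simp only [div_neg, ← neg_div]
      exact hc.trans (mul_le_mul_of_nonneg_right hsg (by positivity)))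
  have hN0 : N ≠ 0 := hN.ne
  have hq1 : 2 * (-N) * (1 - q⁻¹) = K * D ^ 2 * q⁻¹ * h ^ 2 := by
    have : 2 * (-N) * (q - 1) = K * D ^ 2 * h ^ 2 := by
      rw [hqdef]; field_simp; ring
    have hq2 : 1 - q⁻¹ = (q - 1) * q⁻¹ := by field_simp
    rw [hq2, ← mul_assoc, this]; ring
  rw [hq1] at hfin
  refine le_trans ?_ hfin
  have h3 : (K * D ^ 2 - ε) * h ^ 2 ≤ K * D ^ 2 * q⁻¹ * h ^ 2 :=
    mul_le_mul_of_nonneg_right hh4.le (by positivity)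
  have h4 : (L * D * h) ^ 2 / -N = -(L ^ 2 / N * D ^ 2 * h ^ 2) := by
    rw [div_neg]; ring
  rw [h4]
  linarith
end

section
/- Let E be a nontrivial finite-dimensional real inner product space, K ∈ ℝ, N < 0, L ≥ 0, and let f : E → ℝ be twice continuously differentiable with D²f(x)(v,v) − ⟨∇f(x),v⟩²/N ≥ K‖v‖² and ‖∇f(x)‖ ≤ L for all x, v ∈ E. Let x, y ∈ E and let ξ, ζ : [0,∞) → E be continuous curves, differentiable on (0,∞), with ξ(0) = x, ζ(0) = y, ξ'(t) = −∇f(ξ(t)) and ζ'(t) = −∇f(ζ(t)) for all t > 0. Then for all t₀, t₁ > 0, setting Θ := (2K + 4L²/N)·(t₁ + √(t₁ t₀) + t₀)/3, one has ‖ξ(t₀) − ζ(t₁)‖² ≤ 2·exp(−Θ)·( ‖x − y‖²/2 − N·(√t₁ − √t₀)²·(exp(Θ) − 1)/Θ ), where (exp(Θ) − 1)/Θ is read as 1 when Θ = 0. -/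
open Real
open scoped RealInnerProductSpace

theorem aux_grad {E : Type*} [NormedAddCommGroup E] [InnerProductSpace ℝ E]
    [FiniteDimensional ℝ E] (f : E → ℝ) (x v : E) :
    ⟪gradient f x, v⟫ = fderiv ℝ f x v := by
  simp [gradient]

theorem aux_point {E : Type*} [NormedAddCommGroup E] [InnerProductSpace ℝ E]
    [FiniteDimensional ℝ E]
    (f : E → ℝ) (hf : ContDiff ℝ 2 f) (K N L : ℝ) (hN : N < 0)
    (hconv : ∀ x v : E, K * ‖v‖ ^ 2 ≤ fderiv ℝ (fderiv ℝ f) x v v - ⟪gradient f x, v⟫ ^ 2 / N)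
    (hLip : ∀ x : E, ‖gradient f x‖ ≤ L) (p q : E) (a b : ℝ) :
    a ^ 2 * ⟪gradient f p, q - p⟫ + N * (b - a) ^ 2
      + (K + 2 * L ^ 2 / N) * ‖q - p‖ ^ 2 * ((b ^ 2 + b * a + a ^ 2) / 3)
      ≤ b ^ 2 * ⟪gradient f q, q - p⟫ := by
  set v := q - p with hv
  set d := b - a with hd
  set c := (K + 2 * L ^ 2 / N) * ‖v‖ ^ 2 with hc
  have hdf : Differentiable ℝ (fderiv ℝ f) :=
    (hf.fderiv_right (m := 1) (by norm_num)).differentiable (by norm_num)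
  let z : ℝ → E := fun r => p + r • v
  have hz : ∀ r, HasDerivAt z v r := fun r => by
    exact (((hasDerivAt_id' r).smul_const v).const_add p).congr_deriv (one_smul ℝ v)
  let g : ℝ → ℝ := fun r => fderiv ℝ f (z r) v
  have hg : ∀ r, HasDerivAt g (fderiv ℝ (fderiv ℝ f) (z r) v v) r := fun r => by
    have h1 := (hdf (z r)).hasFDerivAt.comp_hasDerivAt r (hz r)
    exact (ContinuousLinearMap.apply ℝ ℝ v).hasFDerivAt.comp_hasDerivAt r h1
  let H : ℝ → ℝ := fun r => (a + r * d) ^ 2 * g r - N * d ^ 2 * r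
    - c * (a ^ 2 * r + a * d * r ^ 2 + d ^ 2 * r ^ 3 / 3)
  have hH : ∀ r, HasDerivAt H (2 * (a + r * d) * d * g r
      + (a + r * d) ^ 2 * fderiv ℝ (fderiv ℝ f) (z r) v v - N * d ^ 2
      - c * (a + r * d) ^ 2) r := fun r => by
    have h0 := hasDerivAt_id' r
    have h1 := (((h0.mul_const d).const_add a).pow 2).mul (hg r)
    have h2 := h0.const_mul (N * d ^ 2)
    have h3 := (((h0.const_mul (a ^ 2)).add ((h0.pow 2).const_mul (a * d))).add
      (((h0.pow 3).const_mul (d ^ 2)).div_const 3)).const_mul c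
    refine (((h1.sub h2).sub h3).congr_deriv ?_)
    simp only [Pi.pow_apply]
    push_cast
    ring
  have hmono : Monotone H := by
    refine monotone_of_hasDerivAt_nonneg hH fun r => ?_
    have h1 := hconv (z r) v
    have h2 : ⟪gradient f (z r), v⟫ = g r := aux_grad f _ _
    have h3 : (g r) ^ 2 ≤ L ^ 2 * ‖v‖ ^ 2 := by
      rw [← h2, ← mul_pow, ← sq_abs]
      refine pow_le_pow_left₀ (abs_nonneg _) ?_ 2
      exact (abs_real_inner_le_norm _ _).trans
        (mul_le_mul_of_nonneg_right (hLip _) (norm_nonneg _))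
    rw [h2] at h1
    have hNi : N⁻¹ < 0 := inv_lt_zero.mpr hN
    have hNN : N * N⁻¹ = 1 := mul_inv_cancel₀ hN.ne
    simp only [div_eq_mul_inv] at h1 hc
    set m := N⁻¹ with hm
    set t := a + r * d with ht
    have h4 : t ^ 2 * (K * ‖v‖ ^ 2 + g r ^ 2 * m) ≤ t ^ 2 * fderiv ℝ (fderiv ℝ f) (z r) v v :=
      mul_le_mul_of_nonneg_left (by linarith) (sq_nonneg t)
    have h5 : 0 ≤ (t ^ 2 * (-m)) * (L ^ 2 * ‖v‖ ^ 2 - g r ^ 2) :=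
      mul_nonneg (mul_nonneg (sq_nonneg t) (by linarith)) (by linarith)
    have h6 : 0 ≤ (-m) * (t * g r - N * d) ^ 2 := mul_nonneg (by linarith) (sq_nonneg _)
    have h7 : (-m) * (t * g r - N * d) ^ 2
        = -m * t ^ 2 * g r ^ 2 + 2 * t * g r * d * (N * m) - N * d ^ 2 * (N * m) := by ring
    rw [h7, hNN] at h6
    show 0 ≤ _
    rw [hc]
    nlinarith [h4, h5, h6]
  have hfin := hmono (zero_le_one (α := ℝ))
  have e0 : z 0 = p := by simp [z]
  have e1 : z 1 = q := by simp [z, hv]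
  rw [aux_grad, aux_grad]
  simp only [H, g, e0, e1, hd] at hfin
  ring_nf at hfin ⊢
  linarith

theorem aux_gronwall (h h' φ : ℝ → ℝ) (T C : ℝ) (hc : ContinuousOn h (Set.Icc 0 1))
    (hd : ∀ s ∈ Set.Ioo (0 : ℝ) 1, HasDerivAt h (h' s) s)
    (hle : ∀ s ∈ Set.Ioo (0 : ℝ) 1, h' s ≤ C - T * h s)
    (hφ : ∀ s, HasDerivAt φ (exp (T * s)) s) (hφ0 : φ 0 = 0) :
    h 1 ≤ exp (-T) * (h 0 + C * φ 1) := by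
  have hE : ∀ s, HasDerivAt (fun s => exp (T * s)) (exp (T * s) * T) s := fun s => by
    simpa using ((hasDerivAt_id' s).const_mul T).exp
  have hanti : AntitoneOn (fun s => exp (T * s) * h s - C * φ s) (Set.Icc 0 1) := by
    have hder : ∀ s ∈ Set.Ioo (0 : ℝ) 1, HasDerivAt (fun s => exp (T * s) * h s - C * φ s)
        (exp (T * s) * T * h s + exp (T * s) * h' s - C * exp (T * s)) s := fun s hs =>
      ((hE s).mul (hd s hs)).sub ((hφ s).const_mul C)
    refine antitoneOn_of_deriv_nonpos (convex_Icc 0 1) ?_ ?_ ?_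
    · have hφc : Continuous φ := continuous_iff_continuousAt.2 fun s => (hφ s).continuousAt
      exact ((by fun_prop : Continuous fun s => exp (T * s)).continuousOn.mul hc).sub
        (continuous_const.mul hφc).continuousOn
    · rw [interior_Icc]
      exact fun s hs => (hder s hs).differentiableAt.differentiableWithinAt
    · rw [interior_Icc]
      intro s hs
      rw [(hder s hs).deriv]
      nlinarith [hle s hs, exp_pos (T * s)]
  have := hanti (Set.left_mem_Icc.2 zero_le_one) (Set.right_mem_Icc.2 zero_le_one) zero_le_one
  simp only [mul_zero, exp_zero, mul_one, one_mul, hφ0, sub_zero] at this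
  have h2 : exp (-T) * (exp T * h 1) = h 1 := by
    rw [← mul_assoc, ← exp_add]; simp
  rw [← h2]
  exact mul_le_mul_of_nonneg_left (by linarith) (exp_pos _).le

theorem stmt_12 {E : Type*} [NormedAddCommGroup E] [InnerProductSpace ℝ E]
    [FiniteDimensional ℝ E] [Nontrivial E]
    (f : E → ℝ) (hf : ContDiff ℝ 2 f) (K N L : ℝ) (hN : N < 0) (hL : 0 ≤ L)
    (hconv : ∀ x v : E, K * ‖v‖ ^ 2 ≤ fderiv ℝ (fderiv ℝ f) x v v - ⟪gradient f x, v⟫ ^ 2 / N)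
    (hLip : ∀ x : E, ‖gradient f x‖ ≤ L)
    (x y : E) (ξ ζ : ℝ → E)
    (hξc : ContinuousOn ξ (Set.Ici 0)) (hζc : ContinuousOn ζ (Set.Ici 0))
    (hξ0 : ξ 0 = x) (hζ0 : ζ 0 = y)
    (hξ' : ∀ t : ℝ, 0 < t → HasDerivAt ξ (-(gradient f (ξ t))) t)
    (hζ' : ∀ t : ℝ, 0 < t → HasDerivAt ζ (-(gradient f (ζ t))) t) :
    ∀ t₀ t₁ : ℝ, 0 < t₀ → 0 < t₁ →
      ‖ξ t₀ - ζ t₁‖ ^ 2 ≤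
        2 * Real.exp (-((2 * K + 4 * L ^ 2 / N) * ((t₁ + Real.sqrt (t₁ * t₀) + t₀) / 3))) *
          (‖x - y‖ ^ 2 / 2 - N * (Real.sqrt t₁ - Real.sqrt t₀) ^ 2 *
            (if (2 * K + 4 * L ^ 2 / N) * ((t₁ + Real.sqrt (t₁ * t₀) + t₀) / 3) = 0 then 1
             else (Real.exp ((2 * K + 4 * L ^ 2 / N) * ((t₁ + Real.sqrt (t₁ * t₀) + t₀) / 3)) - 1)
               / ((2 * K + 4 * L ^ 2 / N) * ((t₁ + Real.sqrt (t₁ * t₀) + t₀) / 3)))) := by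
  intro t₀ t₁ ht₀ ht₁
  set T := (2 * K + 4 * L ^ 2 / N) * ((t₁ + Real.sqrt (t₁ * t₀) + t₀) / 3) with hT
  have ha : √t₀ ^ 2 = t₀ := Real.sq_sqrt ht₀.le
  have hb : √t₁ ^ 2 = t₁ := Real.sq_sqrt ht₁.le
  have hab : √(t₁ * t₀) = √t₁ * √t₀ := Real.sqrt_mul ht₁.le _
  have hscal : ∀ (η : ℝ → E) (t : ℝ), 0 < t →
      (∀ s, 0 < s → HasDerivAt η (-(gradient f (η s))) s) → ∀ s, 0 < s →
      HasDerivAt (fun s => η (t * s)) (t • (-(gradient f (η (t * s))))) s := by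
    intro η t ht hη s hs
    have h1 : HasDerivAt (fun s : ℝ => t * s) t s := by
      simpa using (hasDerivAt_id' s).const_mul t
    exact (hη (t * s) (by positivity)).scomp s h1
  have hcont : ∀ (η : ℝ → E) (t : ℝ), 0 < t → ContinuousOn η (Set.Ici 0) →
      ContinuousOn (fun s => η (t * s)) (Set.Icc 0 1) := by
    intro η t ht hη
    refine hη.comp (by fun_prop) fun s hs => ?_
    exact mul_nonneg ht.le hs.1
  let w : ℝ → E := fun s => ζ (t₁ * s) - ξ (t₀ * s)
  let w' : ℝ → E := fun s => t₁ • (-(gradient f (ζ (t₁ * s)))) - t₀ • (-(gradient f (ξ (t₀ * s))))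
  have hw : ∀ s, 0 < s → HasDerivAt w (w' s) s := fun s hs =>
    (hscal ζ t₁ ht₁ hζ' s hs).sub (hscal ξ t₀ ht₀ hξ' s hs)
  have hwc : ContinuousOn w (Set.Icc 0 1) := (hcont ζ t₁ ht₁ hζc).sub (hcont ξ t₀ ht₀ hξc)
  have key : ∀ φ : ℝ → ℝ, (∀ s, HasDerivAt φ (exp (T * s)) s) → φ 0 = 0 →
      ‖w 1‖ ^ 2 / 2 ≤ exp (-T) * (‖w 0‖ ^ 2 / 2 + (-N * (√t₁ - √t₀) ^ 2) * φ 1) := by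
    intro φ hφ hφ0
    refine aux_gronwall (fun s => ‖w s‖ ^ 2 / 2) (fun s => ⟪w s, w' s⟫) φ T _
      ((hwc.norm.pow 2).div_const 2) ?_ ?_ hφ hφ0
    · intro s hs
      refine ((hw s hs.1).norm_sq.div_const 2).congr_deriv ?_
      ring
    · intro s hs
      have hp := aux_point f hf K N L hN hconv hLip (ξ (t₀ * s)) (ζ (t₁ * s)) √t₀ √t₁
      rw [← hab, ha, hb] at hp
      have e : ⟪w s, w' s⟫ = t₀ * ⟪gradient f (ξ (t₀ * s)), w s⟫
          - t₁ * ⟪gradient f (ζ (t₁ * s)), w s⟫ := by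
        simp only [w', inner_sub_right, inner_neg_right, inner_smul_right,
          real_inner_comm (w s)]
        ring
      show ⟪w s, w' s⟫ ≤ _ - T * (‖w s‖ ^ 2 / 2)
      rw [e]
      have e2 : T * (‖w s‖ ^ 2 / 2) = (K + 2 * L ^ 2 / N) * ‖w s‖ ^ 2
          * ((t₁ + √(t₁ * t₀) + t₀) / 3) := by rw [hT]; ring
      rw [e2]
      simp only [w]
      linarith
  have hw0 : ‖w 0‖ = ‖x - y‖ := by
    simp only [w, mul_zero, hξ0, hζ0]; exact norm_sub_rev _ _
  have hw1 : ‖w 1‖ = ‖ξ t₀ - ζ t₁‖ := by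
    simp only [w, mul_one]; exact norm_sub_rev _ _
  rw [hw0, hw1] at key
  by_cases h0 : T = 0
  · rw [if_pos h0]
    have := key (fun s => s) (fun s => by simpa [h0] using hasDerivAt_id' s) rfl
    linarith
  · rw [if_neg h0]
    have := key (fun s => (exp (T * s) - 1) / T) (fun s => by
      have h1 : HasDerivAt (fun s => exp (T * s)) (exp (T * s) * T) s := by
        simpa using ((hasDerivAt_id' s).const_mul T).exp
      refine ((h1.sub_const 1).div_const T).congr_deriv ?_
      field_simp) (by simp)
    simp only [mul_one] at this
    linarith
end

section
/- Let E be a nontrivial finite-dimensional real inner product space, K ∈ ℝ, N < 0, and let f : E → ℝ be continuously differentiable and bounded below. Let ξ : [0,T) → E be continuous and continuously differentiable on (0,T) such that for every z ∈ E and every t ∈ (0,T) (with ‖ξ(t) − z‖ < π√(N/K) when K < 0) the derivative D at t of s ↦ 𝔰_{K/N}(‖ξ(s) − z‖/2)² satisfies D + K·𝔰_{K/N}(‖ξ(t) − z‖/2)² ≤ (N/2)·(1 − f_N(z)/f_N(ξ(t))). Then for all 0 < t₀ ≤ t₁ < T with sup_{t ∈ [t₀,t₁]} ‖ξ(t) −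 ξ(t₀)‖ < π√(N/K) when K < 0, one has the uniform continuity estimate 𝔰_{K/N}(‖ξ(t₀) − ξ(t₁)‖/2)² ≤ (N·(1 − exp(K(t₀−t₁)))/(2K))·(1 − f_N(ξ(t₀))/inf_{x ∈ E} f_N(x)), where N(1 − exp(K(t₀−t₁)))/(2K) is read as N(t₁−t₀)/2 when K = 0. -/
open Real
open scoped RealInnerProductSpace

theorem stmt_15 {E : Type*} [NormedAddCommGroup E] [InnerProductSpace ℝ E]
    [FiniteDimensional ℝ E] [Nontrivial E]
    (f : E → ℝ) (hf : ContDiff ℝ 1 f) (hbdd : BddBelow (Set.range f))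
    (K N : ℝ) (hN : N < 0)
    (T : ℝ) (ξ ξ' : ℝ → E)
    (hξc : ContinuousOn ξ (Set.Ico 0 T))
    (hξd : ∀ t ∈ Set.Ioo (0:ℝ) T, HasDerivAt ξ (ξ' t) t)
    (hξ'c : ContinuousOn ξ' (Set.Ioo 0 T))
    (hEVI : ∀ z : E, ∀ t ∈ Set.Ioo (0:ℝ) T, (K < 0 → ‖ξ t - z‖ < π * Real.sqrt (N / K)) →
      ∃ D : ℝ, HasDerivAt (fun s => sk (K / N) (‖ξ s - z‖ / 2) ^ 2) D t ∧
        D + K * sk (K / N) (‖ξ t - z‖ / 2) ^ 2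
          ≤ N / 2 * (1 - Real.exp (-f z / N) / Real.exp (-f (ξ t) / N))) :
    ∀ t₀ t₁ : ℝ, 0 < t₀ → t₀ ≤ t₁ → t₁ < T →
      (K < 0 → ∀ t ∈ Set.Icc t₀ t₁, ‖ξ t - ξ t₀‖ < π * Real.sqrt (N / K)) →
      sk (K / N) (‖ξ t₀ - ξ t₁‖ / 2) ^ 2
        ≤ (if K = 0 then N * (t₁ - t₀) / 2
            else N * (1 - Real.exp (K * (t₀ - t₁))) / (2 * K)) *
          (1 - Real.exp (-f (ξ t₀) / N) / (⨅ x : E, Real.exp (-f x / N))) := by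
  intro t₀ t₁ h0 h01 h1 hd
  obtain ⟨m, hm⟩ := hbdd
  have hlow : ∀ x : E, Real.exp (-m / N) ≤ Real.exp (-f x / N) := by
    intro x
    apply Real.exp_le_exp.mpr
    have hx : m ≤ f x := hm ⟨x, rfl⟩
    exact div_le_div_of_nonpos_of_le hN.le (by linarith)
  set I : ℝ := ⨅ x : E, Real.exp (-f x / N) with hI
  have hIpos : 0 < I := lt_of_lt_of_le (Real.exp_pos _) (le_ciInf hlow)
  have hIle : ∀ x : E, I ≤ Real.exp (-f x / N) := fun x =>
    ciInf_le ⟨Real.exp (-m / N), by rintro _ ⟨y, rfl⟩; exact hlow y⟩ x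
  set C : ℝ := N / 2 * (1 - Real.exp (-f (ξ t₀) / N) / I) with hC
  obtain ⟨P, hP, hPd⟩ : ∃ P : ℝ → ℝ, (∀ t, HasDerivAt P (Real.exp (K * t)) t) ∧
      P t₁ - P t₀ = Real.exp (K * t₁) * (if K = 0 then t₁ - t₀
        else (1 - Real.exp (K * (t₀ - t₁))) / K) := by
    by_cases hK : K = 0
    · refine ⟨fun t => t, fun t => ?_, by simp [hK]⟩
      simpa [hK] using hasDerivAt_id' t
    · refine ⟨fun t => Real.exp (K * t) / K, fun t => ?_, ?_⟩
      · have := (((hasDerivAt_id t).const_mul K).exp).div_const K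
        simpa [hK] using this
      · have h2 : Real.exp (K * t₀) = Real.exp (K * t₁) * Real.exp (K * (t₀ - t₁)) := by
          rw [← Real.exp_add]; ring_nf
        simp only [hK, if_false]
        rw [h2]; ring
  set g : ℝ → ℝ := fun s => sk (K / N) (‖ξ s - ξ t₀‖ / 2) ^ 2 with hg
  have key : ∀ t ∈ Set.Icc t₀ t₁, ∃ D : ℝ, HasDerivAt g D t ∧ D + K * g t ≤ C := by
    intro t ht
    obtain ⟨D, hD, hle⟩ := hEVI (ξ t₀) t ⟨by linarith [ht.1], by linarith [ht.2]⟩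
      (fun hK => hd hK t ht)
    refine ⟨D, hD, hle.trans ?_⟩
    apply mul_le_mul_of_nonpos_left _ (by linarith)
    have := div_le_div_of_nonneg_left (Real.exp_pos (-f (ξ t₀) / N)).le hIpos (hIle (ξ t))
    linarith
  have hanti : AntitoneOn (fun t => Real.exp (K * t) * g t - C * P t) (Set.Icc t₀ t₁) := by
    have hder : ∀ t ∈ Set.Icc t₀ t₁, ∃ D' : ℝ,
        HasDerivAt (fun t => Real.exp (K * t) * g t - C * P t) D' t ∧ D' ≤ 0 := by
      intro t ht
      obtain ⟨D, hD, hle⟩ := key t ht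
      have he := ((hasDerivAt_id t).const_mul K).exp
      refine ⟨_, (he.mul hD).sub ((hP t).const_mul C), ?_⟩
      have := mul_nonneg (Real.exp_pos (K * t)).le (sub_nonneg.mpr hle)
      simp only [id]
      nlinarith
    apply antitoneOn_of_deriv_nonpos (convex_Icc _ _)
    · intro t ht
      obtain ⟨D, hD, _⟩ := hder t ht
      exact hD.continuousAt.continuousWithinAt
    · intro t ht
      obtain ⟨D, hD, _⟩ := hder t (interior_subset ht)
      exact hD.differentiableAt.differentiableWithinAt
    · intro t ht
      obtain ⟨D, hD, h⟩ := hder t (interior_subset ht)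
      rw [hD.deriv]; exact h
  have hfin := hanti ⟨le_rfl, h01⟩ ⟨h01, le_rfl⟩ h01
  have hg0 : g t₀ = 0 := by simp [hg, sk]
  simp only [hg0] at hfin
  rw [norm_sub_rev]
  change g t₁ ≤ _
  have h3 : Real.exp (K * t₁) * g t₁ ≤ Real.exp (K * t₁) * (C * (if K = 0 then t₁ - t₀
        else (1 - Real.exp (K * (t₀ - t₁))) / K)) := by
    have : C * (P t₁ - P t₀) = _ := congrArg (C * ·) hPd
    linarith
  refine (le_of_mul_le_mul_left h3 (Real.exp_pos _)).trans (le_of_eq ?_)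
  rw [hC]
  split_ifs with hK
  · ring
  · field_simp
end

section
/- Let n ≥ 1, N < 0, and let u, ψ : ℝⁿ → ℝ be smooth. Define Δg(x) := trace of the Hessian of g at x, the weighted Laplacian Δ_ψ g := Δg − ⟨∇g, ∇ψ⟩, and the weighted Ricci curvature Ric_N(v)(x) := D²ψ(x)(v,v) − ⟨∇ψ(x), v⟩²/(N − n) for v ∈ ℝⁿ. Then for every x ∈ ℝⁿ, Δ_ψ(‖∇u‖²/2)(x) − ⟨∇(Δ_ψ u)(x), ∇u(x)⟩ ≥ Ric_N(∇u(x))(x) + (Δ_ψ u(x))²/N. -/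
open Real
open scoped RealInnerProductSpace

/-- The (unweighted) Laplacian on `ℝⁿ`: trace of the Hessian. -/
noncomputable def lap {n : ℕ} (g : EuclideanSpace ℝ (Fin n) → ℝ)
    (x : EuclideanSpace ℝ (Fin n)) : ℝ :=
  ∑ i, fderiv ℝ (fderiv ℝ g) x (EuclideanSpace.single i 1) (EuclideanSpace.single i 1)

/-- The weighted Laplacian `Δ_ψ g = Δ g - ⟨∇g, ∇ψ⟩`. -/
noncomputable def wlap {n : ℕ} (ψ g : EuclideanSpace ℝ (Fin n) → ℝ)
    (x : EuclideanSpace ℝ (Fin n)) : ℝ :=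
  lap g x - ⟪gradient g x, gradient ψ x⟫

/-- The weighted Ricci curvature `Ric_N(v)(x)` on `ℝⁿ` (flat Ricci tensor). -/
noncomputable def ricN {n : ℕ} (N : ℝ) (ψ : EuclideanSpace ℝ (Fin n) → ℝ)
    (v x : EuclideanSpace ℝ (Fin n)) : ℝ :=
  fderiv ℝ (fderiv ℝ ψ) x v v - ⟪gradient ψ x, v⟫ ^ 2 / (N - n)


abbrev ES (n : ℕ) := EuclideanSpace ℝ (Fin n)

/-- partial derivative -/
noncomputable def pd {n : ℕ} (i : Fin n) (f : ES n → ℝ) (x : ES n) : ℝ :=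
  fderiv ℝ f x (EuclideanSpace.single i 1)

abbrev Sm {n : ℕ} (f : ES n → ℝ) : Prop := ContDiff ℝ (⊤ : ℕ∞) f

lemma Sm.fd {n : ℕ} {f : ES n → ℝ} (hf : Sm f) : ContDiff ℝ (⊤ : ℕ∞) (fderiv ℝ f) :=
  hf.fderiv_right (by simp)

lemma Sm.diff {n : ℕ} {f : ES n → ℝ} (hf : Sm f) : Differentiable ℝ f :=
  hf.differentiable (by simp)

lemma Sm.pd {n : ℕ} {f : ES n → ℝ} (hf : Sm f) (i : Fin n) : Sm (pd i f) :=
  hf.fd.clm_apply contDiff_const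

lemma grad_apply {n : ℕ} (f : ES n → ℝ) (x : ES n) (i : Fin n) :
    gradient f x i = pd i f x := by
  have h : ⟪gradient f x, EuclideanSpace.single i (1:ℝ)⟫ = pd i f x := by
    simp [gradient, pd]
  rw [← h, EuclideanSpace.inner_single_right]
  simp

lemma inner_eq {n : ℕ} (v w : ES n) : ⟪v, w⟫ = ∑ i, v i * w i := by
  simp [PiLp.inner_apply, mul_comm]

lemma hess_eq {n : ℕ} {f : ES n → ℝ} (hf : Sm f) (x v : ES n) (i : Fin n) :
    fderiv ℝ (fderiv ℝ f) x v (EuclideanSpace.single i 1) = fderiv ℝ (pd i f) x v := by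
  have hd : DifferentiableAt ℝ (fderiv ℝ f) x := (hf.fd.differentiable (by simp)) x
  have h := (hd.hasFDerivAt.clm_apply (hasFDerivAt_const (EuclideanSpace.single i (1:ℝ)) x)).fderiv
  unfold pd
  rw [h]; simp

lemma vec_sum {n : ℕ} (v : ES n) : v = ∑ i, v i • EuclideanSpace.single i (1:ℝ) := by
  ext j
  simp [Pi.single_apply]

lemma fd_sum {n : ℕ} (f : ES n → ℝ) (x v : ES n) : fderiv ℝ f x v = ∑ i, v i * pd i f x := by
  conv_lhs => rw [vec_sum v]
  simp [pd]

lemma hess_sum {n : ℕ} {f : ES n → ℝ} (hf : Sm f) (x v : ES n) :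
    fderiv ℝ (fderiv ℝ f) x v v = ∑ k, ∑ i, v k * v i * pd k (pd i f) x := by
  have h1 : fderiv ℝ (fderiv ℝ f) x v v
      = ∑ i, v i * fderiv ℝ (fderiv ℝ f) x v (EuclideanSpace.single i 1) := by
    conv_lhs => arg 2; rw [vec_sum v]
    simp
  rw [h1, Finset.sum_comm]
  refine Finset.sum_congr rfl fun i _ => ?_
  rw [hess_eq hf, fd_sum, Finset.mul_sum]
  exact Finset.sum_congr rfl fun k _ => by ring

lemma pd_comm {n : ℕ} {f : ES n → ℝ} (hf : Sm f) (i k : Fin n) :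
    pd i (pd k f) = pd k (pd i f) := by
  ext x
  have hs : IsSymmSndFDerivAt ℝ f x := hf.contDiffAt.isSymmSndFDerivAt (by
    simp only [minSmoothness_of_isRCLikeNormedField]
    exact WithTop.coe_le_coe.2 (le_top : (2 : ℕ∞) ≤ ⊤))
  have := hs.eq (EuclideanSpace.single i 1) (EuclideanSpace.single k 1)
  rwa [hess_eq hf, hess_eq hf] at this

lemma lap_eq {n : ℕ} {f : ES n → ℝ} (hf : Sm f) (x : ES n) :
    lap f x = ∑ i, pd i (pd i f) x :=
  Finset.sum_congr rfl fun i _ => hess_eq hf x _ i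

lemma pd_sum {n m : ℕ} {F : Fin m → ES n → ℝ} (hF : ∀ k, Sm (F k)) (i : Fin n) (x : ES n) :
    pd i (fun y => ∑ k, F k y) x = ∑ k, pd i (F k) x := by
  unfold pd
  rw [fderiv_fun_sum fun k _ => (hF k).diff x]
  simp

lemma pd_mul {n : ℕ} {f g : ES n → ℝ} (hf : Sm f) (hg : Sm g) (i : Fin n) (x : ES n) :
    pd i (fun y => f y * g y) x = f x * pd i g x + g x * pd i f x := by
  unfold pd
  rw [fderiv_fun_mul (hf.diff x) (hg.diff x)]
  simp

lemma pd_add {n : ℕ} {f g : ES n → ℝ} (hf : Sm f) (hg : Sm g) (i : Fin n) (x : ES n) :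
    pd i (fun y => f y + g y) x = pd i f x + pd i g x := by
  unfold pd
  rw [fderiv_fun_add (hf.diff x) (hg.diff x)]
  simp

lemma pd_sub {n : ℕ} {f g : ES n → ℝ} (hf : Sm f) (hg : Sm g) (i : Fin n) (x : ES n) :
    pd i (fun y => f y - g y) x = pd i f x - pd i g x := by
  unfold pd
  rw [fderiv_fun_sub (hf.diff x) (hg.diff x)]
  simp

lemma Sm.sum' {n m : ℕ} {F : Fin m → ES n → ℝ} (hF : ∀ k, Sm (F k)) :
    Sm (fun y => ∑ k, F k y) := ContDiff.sum fun k _ => hF k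

lemma energy_eq {n : ℕ} (u : ES n → ℝ) :
    (fun y => ‖gradient u y‖ ^ 2 / 2) = fun y => ∑ k, (1/2 : ℝ) * (pd k u y * pd k u y) := by
  ext y
  rw [← real_inner_self_eq_norm_sq, inner_eq, ← Finset.mul_sum]
  simp only [grad_apply]; ring

lemma pd_energy {n : ℕ} {u : ES n → ℝ} (hu : Sm u) (i : Fin n) :
    pd i (fun y => ∑ k, (1/2 : ℝ) * (pd k u y * pd k u y))
      = fun y => ∑ k, pd k u y * pd i (pd k u) y := by
  ext x
  rw [pd_sum (fun k => contDiff_const.mul ((hu.pd k).mul (hu.pd k)))]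
  refine Finset.sum_congr rfl fun k _ => ?_
  rw [pd_mul contDiff_const ((hu.pd k).mul (hu.pd k)), pd_mul (hu.pd k) (hu.pd k)]
  simp [pd]; ring

lemma bochner {n : ℕ} {u ψ : ES n → ℝ} (hu : Sm u) (hψ : Sm ψ) (x : ES n) :
    wlap ψ (fun y => ‖gradient u y‖ ^ 2 / 2) x
      - ⟪gradient (fun y => wlap ψ u y) x, gradient u x⟫
    = (∑ i, ∑ k, (pd i (pd k u) x) ^ 2)
      + fderiv ℝ (fderiv ℝ ψ) x (gradient u x) (gradient u x) := by
  have hE : Sm (fun y => ∑ k, (1/2 : ℝ) * (pd k u y * pd k u y)) :=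
    Sm.sum' (fun k => contDiff_const.mul ((hu.pd k).mul (hu.pd k)))
  have hw : (fun y => wlap ψ u y)
      = fun y => (∑ i, pd i (pd i u) y) - ∑ i, pd i u y * pd i ψ y := by
    ext y
    simp only [wlap, lap_eq hu, inner_eq, grad_apply]
  have hpw : ∀ k, pd k (fun y => (∑ i, pd i (pd i u) y) - ∑ i, pd i u y * pd i ψ y) x
      = (∑ i, pd k (pd i (pd i u)) x)
        - ∑ i, (pd i u x * pd k (pd i ψ) x + pd i ψ x * pd k (pd i u) x) := by
    intro k
    rw [pd_sub (Sm.sum' fun i => (hu.pd i).pd i) (Sm.sum' fun i => (hu.pd i).mul (hψ.pd i)),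
      pd_sum (fun i => (hu.pd i).pd i), pd_sum (fun i => (hu.pd i).mul (hψ.pd i))]
    congr 1
    exact Finset.sum_congr rfl fun i _ => pd_mul (hu.pd i) (hψ.pd i) k x
  have hppE : ∀ i, pd i (fun y => ∑ k, pd k u y * pd i (pd k u) y) x
      = ∑ k, (pd k u x * pd i (pd i (pd k u)) x + pd i (pd k u) x * pd i (pd k u) x) := by
    intro i
    rw [pd_sum (fun k => (hu.pd k).mul ((hu.pd k).pd i))]
    exact Finset.sum_congr rfl fun k _ => pd_mul (hu.pd k) ((hu.pd k).pd i) i x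
  have hc : ∀ i k, pd k (pd i (pd i u)) x = pd i (pd i (pd k u)) x := by
    intro i k
    rw [pd_comm (hu.pd i), pd_comm hu k i]
  rw [hw, hess_sum hψ, energy_eq]
  unfold wlap
  rw [lap_eq hE, inner_eq, inner_eq]
  simp only [grad_apply, hpw, pd_energy hu, hppE]
  simp only [sub_mul, Finset.sum_mul, Finset.sum_add_distrib, Finset.sum_sub_distrib, add_mul]
  have e1 : ∑ i, ∑ k, pd k u x * pd i (pd i (pd k u)) x
      = ∑ k, ∑ i, pd k (pd i (pd i u)) x * pd k u x := by
    rw [Finset.sum_comm]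
    refine Finset.sum_congr rfl fun k _ => Finset.sum_congr rfl fun i _ => ?_
    rw [hc i k, mul_comm]
  have e2 : ∑ i, ∑ k, pd k u x * pd i (pd k u) x * pd i ψ x
      = ∑ k, ∑ i, pd i ψ x * pd k (pd i u) x * pd k u x := by
    rw [Finset.sum_comm]
    refine Finset.sum_congr rfl fun k _ => Finset.sum_congr rfl fun i _ => ?_
    rw [pd_comm hu i k]; ring
  have e3 : ∑ k, ∑ i, pd i u x * pd k (pd i ψ) x * pd k u x
      = ∑ k, ∑ i, pd k u x * pd i u x * pd k (pd i ψ) x :=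
    Finset.sum_congr rfl fun k _ => Finset.sum_congr rfl fun i _ => by ring
  have e4 : ∑ i, ∑ k, pd i (pd k u) x * pd i (pd k u) x = ∑ i, ∑ k, pd i (pd k u) x ^ 2 :=
    Finset.sum_congr rfl fun k _ => Finset.sum_congr rfl fun i _ => by ring
  rw [e1, e2, e3, e4]; ring

lemma hs_trace {n : ℕ} (A : Fin n → Fin n → ℝ) :
    (∑ i, A i i) ^ 2 ≤ n * ∑ i, ∑ k, A i k ^ 2 := by
  have h := sq_sum_le_card_mul_sum_sq (s := (Finset.univ : Finset (Fin n))) (f := fun i => A i i)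
  simp only [Finset.card_univ, Fintype.card_fin] at h
  refine h.trans (mul_le_mul_of_nonneg_left ?_ (Nat.cast_nonneg n))
  exact Finset.sum_le_sum fun i _ =>
    Finset.single_le_sum (f := fun k => A i k ^ 2) (fun k _ => sq_nonneg _) (Finset.mem_univ i)

lemma alg {n N a b S : ℝ} (hn : 0 < n) (hN : N < 0) (h : a ^ 2 ≤ n * S) :
    - (b ^ 2 / (N - n)) + (a - b) ^ 2 / N ≤ S := by
  have h1 : a ^ 2 / n ≤ S := by rw [div_le_iff₀ hn]; linarith
  refine le_trans ?_ h1
  have hd : N - n < 0 := by linarith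
  have key : a ^ 2 / n - (- (b ^ 2 / (N - n)) + (a - b) ^ 2 / N)
      = (a * (N - n) + n * b) ^ 2 / (n * (-N) * (-(N - n))) := by
    have := hN.ne; have := hd.ne; have := hn.ne'
    field_simp
    ring
  have : 0 ≤ (a * (N - n) + n * b) ^ 2 / (n * (-N) * (-(N - n))) := by
    have : 0 < -N := by linarith
    have : 0 < -(N - n) := by linarith
    positivity
  linarith

theorem stmt_16 (n : ℕ) (hn : 1 ≤ n) (N : ℝ) (hN : N < 0)
    (u ψ : EuclideanSpace ℝ (Fin n) → ℝ)
    (hu : ContDiff ℝ (⊤ : ℕ∞) u) (hψ : ContDiff ℝ (⊤ : ℕ∞) ψ) :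
    ∀ x : EuclideanSpace ℝ (Fin n),
      ricN N ψ (gradient u x) x + (wlap ψ u x) ^ 2 / N
        ≤ wlap ψ (fun y => ‖gradient u y‖ ^ 2 / 2) x
            - ⟪gradient (fun y => wlap ψ u y) x, gradient u x⟫ := by
  intro x
  rw [bochner hu hψ x]
  have hn' : (0:ℝ) < n := by exact_mod_cast hn
  have h := alg (b := ⟪gradient u x, gradient ψ x⟫) hn' hN
    (hs_trace fun i k => pd i (pd k u) x)
  rw [← lap_eq hu] at h
  unfold ricN wlap
  rw [real_inner_comm (gradient u x) (gradient ψ x)]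
  linarith
end

section
/- Let a, b ∈ ℝ, let n > 0 be real, and let N < 0. Then (a + b)²/n = a²/N − b²/(N − n) + (N(N − n)/n)·(a/N + b/(N − n))², and consequently (a + b)²/n ≥ a²/N − b²/(N − n). -/
theorem stmt_17 (a b n N : ℝ) (hn : 0 < n) (hN : N < 0) :
    (a + b) ^ 2 / n
        = a ^ 2 / N - b ^ 2 / (N - n) + N * (N - n) / n * (a / N + b / (N - n)) ^ 2 ∧
    a ^ 2 / N - b ^ 2 / (N - n) ≤ (a + b) ^ 2 / n := by
  have hNn : N - n < 0 := by linarith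
  have h1 : n ≠ 0 := hn.ne'
  have h2 : N ≠ 0 := hN.ne
  have h3 : N - n ≠ 0 := hNn.ne
  have key : (a + b) ^ 2 / n
        = a ^ 2 / N - b ^ 2 / (N - n) + N * (N - n) / n * (a / N + b / (N - n)) ^ 2 := by
    field_simp
    ring
  refine ⟨key, ?_⟩
  rw [key]
  have h4 : 0 ≤ N * (N - n) / n * (a / N + b / (N - n)) ^ 2 :=
    mul_nonneg (div_nonneg (mul_pos_of_neg_of_neg hN hNn).le hn.le) (sq_nonneg _)
  linarith
end

section
/- Let K > 0, N < 0, θ ≥ 0, I ≥ 0 and E ∈ ℝ. Set c := cosh(θ·√(K/(−N))) and s := sinh(θ·√(K/(−N)))·√(−N/K). If c + (s/N)·√I > 0 and exp(E/N) ≥ c + (s/N)·√I, then K·N·(exp(2E/N) − 1) ≤ I. -/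
open Real

theorem stmt_19 (K N θ I E : ℝ) (hK : 0 < K) (hN : N < 0) (hθ : 0 ≤ θ) (hI : 0 ≤ I)
    (c s : ℝ)
    (hc : c = Real.cosh (θ * Real.sqrt (K / (-N))))
    (hs : s = Real.sinh (θ * Real.sqrt (K / (-N))) * Real.sqrt (-N / K))
    (hpos : 0 < c + s / N * Real.sqrt I)
    (hHWI : c + s / N * Real.sqrt I ≤ Real.exp (E / N)) :
    K * N * (Real.exp (2 * E / N) - 1) ≤ I := by
  have hN0 : N ≠ 0 := hN.ne
  have hcs : c ^ 2 = 1 - K / N * s ^ 2 := by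
    have h1 : Real.sqrt (-N / K) ^ 2 = -N / K :=
      Real.sq_sqrt (div_nonneg (by linarith) hK.le)
    rw [hc, hs, Real.cosh_sq, mul_pow, h1]
    field_simp
    ring
  have hr : Real.sqrt I ^ 2 = I := Real.sq_sqrt hI
  have hexp : Real.exp (2 * E / N) = Real.exp (E / N) ^ 2 := by
    rw [← Real.exp_nat_mul]
    congr 1
    push_cast
    ring
  rw [hexp]
  generalize Real.sqrt I = r at *
  have hsq : (c + s / N * r) ^ 2 ≤ Real.exp (E / N) ^ 2 :=
    pow_le_pow_left₀ hpos.le hHWI 2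
  have hKN : K * N ≤ 0 := (mul_neg_of_pos_of_neg hK hN).le
  have h2 : K * N * (Real.exp (E / N) ^ 2 - 1) ≤ K * N * ((c + s / N * r) ^ 2 - 1) :=
    mul_le_mul_of_nonpos_left (by linarith) hKN
  have h3 : K * N * ((c + s / N * r) ^ 2 - 1) = r ^ 2 - (K * s - c * r) ^ 2 := by
    have e1 : (c + s / N * r) ^ 2 = c ^ 2 + 2 * c * s * r / N + s ^ 2 * r ^ 2 / N ^ 2 := by
      ring
    have e2 : (K * s - c * r) ^ 2 = K ^ 2 * s ^ 2 - 2 * K * s * c * r + c ^ 2 * r ^ 2 := by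
      ring
    rw [e1, e2, hcs]
    field_simp
    ring
  nlinarith [sq_nonneg (K * s - c * r)]
end
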